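/- arXiv:1703.00282 — 4 statements merged into one kernel-verified Lean document; each statement's English description precedes it below -/
import Mathlib

section
/- Let (E,d) be a complete metric space and p ≥ 1. A locally p-integrable function f : ℝ → E is S^p-almost periodic if and only if its Bochner transform f^b : ℝ → L^p((0,1);E), defined by f^b(t) = f(t+·), is Bohr almost periodic with respect to the metric D_{L^p}(u,v) = (∫_0^1 d(u(s),v(s))^p ds)^{1/p}. -/
open MeasureTheory Filter Topology

/-- A set `A ⊆ ℝ` is relatively dense. -/
def RelDense (A : Set ℝ) : Prop := ∃ l > 0, ∀ a : ℝ, ∃ τ ∈ A, τ ∈ Set.Icc a (a + l)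

/-- `f` is Stepanov almost periodic of order `p`: for every `ε > 0`, the set of `τ` with
`D_{S^p}(f(·+τ), f) ≤ ε` (i.e. every window integral is `≤ ε^p`) is relatively dense. -/
def SpAP {E : Type*} [PseudoMetricSpace E] (p : ℝ) (f : ℝ → E) : Prop :=
  ∀ ε > 0, RelDense {τ : ℝ | ∀ x : ℝ,
    (∫ t in x..(x + 1), dist (f (t + τ)) (f t) ^ p) ^ (1 / p) ≤ ε}

/-- Local `p`-integrability of a metric-space valued function. -/
def LocInt {E : Type*} [PseudoMetricSpace E] (p : ℝ) (f : ℝ → E) : Prop :=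
  ∀ (x₀ : E) (a b : ℝ), IntervalIntegrable (fun t => dist (f t) x₀ ^ p) volume a b

theorem RelDense.mono {A B : Set ℝ} (hA : RelDense A) (hAB : A ⊆ B) : RelDense B := by
  obtain ⟨l, hl, h⟩ := hA
  exact ⟨l, hl, fun a ↦ (h a).imp fun τ hτ ↦ ⟨hAB hτ.1, hτ.2⟩⟩

open Set in
/-- In a second-countable space, a closed set with uncountable image under a continuous map
contains two small closed sets with disjoint uncountable images. -/
theorem Continuous.exists_splitting_of_not_countable_image {X Z : Type*} [PseudoEMetricSpace X]
    [SecondCountableTopology X] [TopologicalSpace Z] [T25Space Z] {h : X → Z} (hh : Continuous h)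
    {C : Set X} (hC : IsClosed C) (hunc : ¬(h '' C).Countable) {ε : ENNReal} (hε : 0 < ε) :
    ∃ C₀ C₁ : Set X,
      ((IsClosed C₀ ∧ ¬(h '' C₀).Countable) ∧ C₀ ⊆ C ∧ Metric.ediam C₀ ≤ ε) ∧
      ((IsClosed C₁ ∧ ¬(h '' C₁).Countable) ∧ C₁ ⊆ C ∧ Metric.ediam C₁ ≤ ε) ∧
      Disjoint (h '' C₀) (h '' C₁) := by
  set N : Set X := {x | ∃ u ∈ 𝓝[C] x, (h '' u).Countable}
  obtain ⟨x, y, hx, hy, hxy⟩ : ∃ x y, x ∈ C \ N ∧ y ∈ C \ N ∧ h x ≠ h y := by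
    by_contra! hcon
    have hsub : (h '' (C \ N)).Subsingleton := by
      rintro _ ⟨x, hx, rfl⟩ _ ⟨y, hy, rfl⟩
      exact hcon x y hx hy
    have hN : (h '' (C ∩ N)).Countable := by
      have hloc : ∀ x ∈ C ∩ N, ∃ u ∈ 𝓝[C ∩ N] x, (h '' u).Countable := by
        rintro x ⟨_, u, hu, hcount⟩
        exact ⟨u, nhdsWithin_mono _ inter_subset_left hu, hcount⟩
      choose! u hu hcount using hloc
      obtain ⟨t, htC, ht, hcover⟩ := TopologicalSpace.countable_cover_nhdsWithin hu
      refine (ht.biUnion fun x hx ↦ hcount x (htC hx)).mono ?_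
      rw [← image_iUnion₂]
      exact image_mono hcover
    refine hunc ((hN.union hsub.countable).mono ?_)
    rw [← image_union, inter_union_sdiff]
  obtain ⟨U, hxU, V, hyV, hUV⟩ := exists_nhds_disjoint_closure hxy
  have key : ∀ z ∈ C \ N, ∀ W ∈ 𝓝 (h z), ∃ D : Set X,
      ((IsClosed D ∧ ¬(h '' D).Countable) ∧ D ⊆ C ∧ Metric.ediam D ≤ ε) ∧
        h '' D ⊆ closure W := by
    intro z hz W hW
    have hε2 : ε / 2 ≠ 0 := by simpa using hε.ne'
    refine ⟨C ∩ (Metric.closedEBall z (ε / 2) ∩ h ⁻¹' closure W), ⟨⟨?_, fun hcount ↦ ?_⟩,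
      inter_subset_left, ?_⟩, ?_⟩
    · exact hC.inter (Metric.isClosed_closedEBall.inter (isClosed_closure.preimage hh))
    · refine hz.2 ⟨_, ?_, hcount⟩
      refine inter_mem self_mem_nhdsWithin (mem_nhdsWithin_of_mem_nhds (inter_mem ?_ ?_))
      · exact Metric.closedEBall_mem_nhds _ (pos_iff_ne_zero.2 hε2)
      · exact hh.continuousAt (mem_of_superset hW subset_closure)
    · refine (Metric.ediam_mono (inter_subset_right.trans inter_subset_left)).trans ?_
      exact Metric.ediam_closedEBall_le.trans_eq (ENNReal.mul_div_cancel two_ne_zero (by simp))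
    · rintro _ ⟨w, hw, rfl⟩
      exact hw.2.2
  obtain ⟨C₀, h₀, hU⟩ := key x hx U hxU
  obtain ⟨C₁, h₁, hV⟩ := key y hy V hyV
  exact ⟨C₀, C₁, h₀, h₁, hUV.mono hU hV⟩

open CantorScheme Set in
/-- If a continuous map on a Polish space has uncountable range, then it is injective on the image
of some injection of the Cantor space. -/
theorem Continuous.exists_nat_bool_injective_comp {X Z : Type*} [TopologicalSpace X] [PolishSpace X]
    [TopologicalSpace Z] [T25Space Z] {h : X → Z} (hh : Continuous h)
    (hunc : ¬(range h).Countable) :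
    ∃ φ : (ℕ → Bool) → X, Function.Injective (h ∘ φ) := by
  let := TopologicalSpace.upgradeIsCompletelyMetrizable X
  obtain ⟨u, -, upos', hu⟩ := exists_seq_strictAnti_tendsto' (zero_lt_one' ENNReal)
  have upos := fun n ↦ (upos' n).1
  choose C₀ C₁ h₀ h₁ hdisj using
    fun {C : Set X} (hC : IsClosed C ∧ ¬(h '' C).Countable) {ε : ENNReal} (hε : 0 < ε) ↦
      hh.exists_splitting_of_not_countable_image hC.1 hC.2 hε
  let P := {C : Set X // IsClosed C ∧ ¬(h '' C).Countable}
  let DP : List Bool → P := fun l ↦ by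
    induction l with
    | nil => exact ⟨univ, isClosed_univ, by rwa [image_univ]⟩
    | cons a l ih =>
      cases a
      · exact ⟨C₀ ih.property (upos (l.length + 1)), (h₀ _ _).1⟩
      · exact ⟨C₁ ih.property (upos (l.length + 1)), (h₁ _ _).1⟩
  let D : List Bool → Set X := fun l ↦ (DP l).val
  have hanti : ClosureAntitone D := by
    refine Antitone.closureAntitone ?_ fun l ↦ (DP l).property.1
    rintro l (_ | _)
    · exact (h₀ _ _).2.1
    · exact (h₁ _ _).2.1
  have hdiam : VanishingDiam D := by
    intro x
    apply tendsto_of_tendsto_of_tendsto_of_le_of_le' tendsto_const_nhds hu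
    · simp
    rw [eventually_atTop]
    refine ⟨1, fun m (hm : 1 ≤ m) ↦ ?_⟩
    obtain ⟨n, rfl⟩ := Nat.exists_eq_succ_of_ne_zero (Nat.one_le_iff_ne_zero.1 hm)
    dsimp
    cases x n
    · convert! (h₀ _ _).2.2
      rw [PiNat.res_length]
    · convert! (h₁ _ _).2.2
      rw [PiNat.res_length]
  have hdisj' : CantorScheme.Disjoint fun l ↦ h '' D l := by
    rintro l (a | a) (b | b) hab <;> try contradiction
    · exact hdisj _ _
    · exact (hdisj _ _).symm
  have hne : ∀ l, (D l).Nonempty := fun l ↦ by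
    by_contra! hl
    exact (DP l).property.2 (by simp [show (DP l).val = ∅ from hl])
  have hdom : ∀ x : ℕ → Bool, x ∈ (inducedMap D).1 := fun x ↦ by
    rw [hanti.map_of_vanishingDiam hdiam hne]
    apply mem_univ
  refine ⟨fun x ↦ (inducedMap D).2 ⟨x, hdom x⟩, fun x y hxy ↦ PiNat.res_injective ?_⟩
  have hmem : ∀ x n, h ((inducedMap D).2 ⟨x, hdom x⟩) ∈ h '' D (PiNat.res x n) := fun x n ↦
    mem_image_of_mem h (map_mem ⟨x, hdom x⟩ n)
  ext n : 1
  induction n with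
  | zero => simp
  | succ n ih =>
    simp only [PiNat.res_succ, List.cons.injEq]
    refine ⟨?_, ih⟩
    by_contra hne
    refine (hdisj' (PiNat.res x n) hne).le_bot ⟨hmem x (n + 1), ?_⟩
    have hy := hmem y (n + 1)
    rw [PiNat.res_succ, ← ih] at hy
    convert! hy using 1

/-- If a measurable map between standard Borel spaces has uncountable range, then it is injective
on the image of some injection of the Cantor space. -/
theorem Measurable.exists_nat_bool_injective_comp {X Z : Type*} [MeasurableSpace X]
    [StandardBorelSpace X] [MeasurableSpace Z] [StandardBorelSpace Z] {h : X → Z}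
    (hh : Measurable h) (hunc : ¬(Set.range h).Countable) :
    ∃ φ : (ℕ → Bool) → X, Function.Injective (h ∘ φ) := by
  let := upgradeStandardBorel X
  let := upgradeStandardBorel Z
  obtain ⟨τ, -, hcont, hτ⟩ := hh.exists_continuous
  exact hcont.exists_nat_bool_injective_comp hunc

open Set in
/-- A Borel measurable map from a standard Borel space to a metric space has separable range. -/
theorem Measurable.isSeparable_range {X E : Type*} [MeasurableSpace X] [StandardBorelSpace X]
    [MetricSpace E] [MeasurableSpace E] [OpensMeasurableSpace E] {f : X → E} (hf : Measurable f) :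
    TopologicalSpace.IsSeparable (range f) := by
  suffices ∀ ε : NNReal, 0 < ε → ∃ t : Set E, t.Countable ∧ Metric.IsCover ε (range f) t by
    have hdense : ∀ ε > 0, ∃ t : Set E, t.Countable ∧
        range f ⊆ ⋃ x ∈ t, Metric.closedEBall x ε := fun ε hε ↦ by
      obtain ⟨δ, hδ, hδε⟩ := ENNReal.lt_iff_exists_nnreal_btwn.1 hε
      obtain ⟨t, ht, hcov⟩ := this δ (by exact_mod_cast hδ)
      exact ⟨t, ht, (Metric.isCover_iff_subset_iUnion_closedEBall.1 hcov).trans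
        (iUnion₂_mono fun x _ ↦ Metric.closedEBall_subset_closedEBall hδε.le)⟩
    obtain ⟨t, -, ht, hsub⟩ := EMetric.subset_countable_closure_of_almost_dense_set _ hdense
    exact ⟨t, ht, hsub⟩
  intro ε hε
  obtain ⟨D, hD⟩ : ∃ D, Maximal (fun D ↦ D ⊆ range f ∧ Metric.IsSeparated ε D) D := by
    refine zorn_subset {D | D ⊆ range f ∧ Metric.IsSeparated ε D} fun c hc hchain ↦
      ⟨⋃₀ c, ⟨sUnion_subset fun D hD ↦ (hc hD).1, ?_⟩, fun D hD ↦ subset_sUnion_of_mem hD⟩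
    exact (pairwise_sUnion hchain.directedOn).2 fun D hD ↦ (hc hD).2
  refine ⟨D, ?_, .of_maximal_isSeparated hD⟩
  by_contra hunc
  have hclosed : ∀ S ⊆ D, IsClosed S := fun S hS ↦
    Metric.isClosed_of_pairwise_le_dist (NNReal.coe_pos.2 hε) fun x hx y hy hxy ↦ by
      have : (ε : ENNReal) < EDist.edist x y := hD.prop.2 (hS hx) (hS hy) hxy
      rw [edist_nndist] at this
      exact_mod_cast this.le
  have hmeas : ∀ S ⊆ D, MeasurableSet (f ⁻¹' S) := fun S hS ↦ hf (hclosed S hS).measurableSet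
  obtain ⟨d, hd⟩ : D.Nonempty := nonempty_iff_ne_empty.2 fun h ↦ hunc (by simp [h])
  have : Nonempty X := ⟨(hD.prop.1 hd).choose⟩
  have hsurj : ∀ y ∈ D, ∃ x, f x = y := fun y hy ↦ hD.prop.1 hy
  choose! s hs using hsurj
  let X' := f ⁻¹' D
  obtain ⟨φ, hφ⟩ : ∃ φ : (ℕ → Bool) → X', Function.Injective fun a ↦ f (φ a) := by
    have : StandardBorelSpace X' := (hmeas D subset_rfl).standardBorel
    let h : X' → X := fun x ↦ s (f x)
    have hh : Measurable h := by
      intro B _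
      convert! measurable_subtype_coe (hmeas (D ∩ s ⁻¹' B) inter_subset_left) using 1
      ext x
      have := x.2
      simp_all [h, X']
    obtain ⟨φ, hφ⟩ := hh.exists_nat_bool_injective_comp fun hcount ↦ by
      refine hunc ((hcount.image f).mono fun y hy ↦ ?_)
      have hfs := hs y hy
      exact ⟨s y, ⟨⟨s y, by simpa [X', hfs] using hy⟩, by simp [h, hfs]⟩, hfs⟩
    exact ⟨φ, fun a b hab ↦ hφ (congrArg s hab)⟩
  have hinj : Function.Injective (fun S : Set (ℕ → Bool) ↦
      (⟨f ⁻¹' ((fun a ↦ f (φ a)) '' S), hmeas _ (by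
        rintro _ ⟨a, -, rfl⟩; exact (φ a).2)⟩ : {B : Set X | MeasurableSet B})) := by
    intro S T hST
    have hpre := congrArg (image f) (congrArg Subtype.val hST)
    have hsub : ∀ U, (fun a ↦ f (φ a)) '' U ⊆ range f := by
      rintro U _ ⟨a, -, rfl⟩
      exact mem_range_self _
    simp only [image_preimage_eq_of_subset (hsub _)] at hpre
    exact hφ.image_injective hpre
  have hle := Cardinal.lift_mk_le_lift_mk_of_injective hinj
  have hcard : Cardinal.mk {B : Set X | MeasurableSet B} ≤ Cardinal.continuum := by
    rw [← MeasurableSpace.generateFrom_countableGeneratingSet (α := X)]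
    exact MeasurableSpace.cardinal_measurableSet_le_continuum
      ((MeasurableSpace.countable_countableGeneratingSet.le_aleph0).trans
        Cardinal.aleph0_le_continuum)
  have := hle.trans (Cardinal.lift_le.2 hcard)
  simp only [Cardinal.mk_set, Cardinal.mk_pi, Cardinal.mk_bool, Cardinal.prod_const,
    Cardinal.mk_nat, Cardinal.lift_uzero, Cardinal.two_power_aleph0, Cardinal.lift_continuum,
    Cardinal.lift_power, Cardinal.lift_ofNat] at this
  exact (Cardinal.cantor _).not_ge this

/-- A Borel measurable map to a metric space is isometric to a strongly measurable map to `ℓ^∞`. -/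
theorem Measurable.exists_stronglyMeasurable_dist_eq {X E : Type*} [MeasurableSpace X]
    [StandardBorelSpace X] [MetricSpace E] [MeasurableSpace E] [OpensMeasurableSpace E] {f : X → E}
    (hf : Measurable f) :
    ∃ F : X → lp (fun _ : ℕ ↦ ℝ) ⊤, StronglyMeasurable F ∧
      ∀ x y, Dist.dist (F x) (F y) = Dist.dist (f x) (f y) := by
  have : TopologicalSpace.SeparableSpace (Set.range f) := hf.isSeparable_range.separableSpace
  have : SecondCountableTopology (Set.range f) := UniformSpace.secondCountable_of_separable _
  have hK := kuratowskiEmbedding.isometry (Set.range f)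
  refine ⟨fun x ↦ kuratowskiEmbedding (Set.range f) ⟨f x, Set.mem_range_self x⟩, ?_,
    fun x y ↦ hK.dist_eq _ _⟩
  exact hK.continuous.comp_stronglyMeasurable hf.subtype_mk.stronglyMeasurable

/-- Translation is continuous in `L^p(ℝ)`. -/
theorem MeasureTheory.MemLp.tendsto_integral_norm_translate_sub {G : Type*} [NormedAddCommGroup G]
    {p : ℝ} (hp : 1 ≤ p) {g : ℝ → G} (hg : MemLp g (ENNReal.ofReal p) volume) :
    Tendsto (fun a ↦ ∫ x, ‖g (x + a) - g x‖ ^ p) (𝓝 0) (𝓝 0) := by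
  have hp0 : 0 < p := one_pos.trans_le hp
  have : Fact (1 ≤ ENNReal.ofReal p) := ⟨by simpa using hp⟩
  let T : ℝ → C(ℝ, ℝ) := fun a ↦ ⟨fun x ↦ x + a, by fun_prop⟩
  have hT : Continuous T := ContinuousMap.continuous_of_continuous_uncurry _ (by
    simp only [Function.uncurry_def, T, ContinuousMap.coe_mk]; fun_prop)
  have hTm : ∀ a, MeasurePreserving (T a) volume volume := fun a ↦
    measurePreserving_add_right volume a
  have hcont := (continuous_const (y := hg.toLp g)).compMeasurePreservingLp hT hTm
    ENNReal.ofReal_ne_top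
  have hlim := tendsto_iff_norm_sub_tendsto_zero.1 (hcont.tendsto 0)
  have hpow := hlim.rpow_const (p := p) (.inr hp0.le)
  rw [Real.zero_rpow hp0.ne'] at hpow
  refine hpow.congr fun a ↦ ?_
  simp only [Lp.toLp_compMeasurePreserving, ← MemLp.toLp_sub, Lp.norm_toLp]
  rw [((hg.comp_measurePreserving (hTm a)).sub
      (hg.comp_measurePreserving (hTm 0))).eLpNorm_eq_integral_rpow_norm (by simpa using hp0)
      ENNReal.ofReal_ne_top, ENNReal.toReal_ofReal hp0.le, ENNReal.toReal_ofReal (by positivity),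
    Real.rpow_inv_rpow (by positivity) hp0.ne']
  simp [T]

/-- The Bochner transform of a locally `p`-integrable function is continuous for the `L^p`
metric. -/
theorem exists_forall_integral_dist_translate_lt {E : Type*} [MetricSpace E]
    [MeasurableSpace E] [OpensMeasurableSpace E] {p : ℝ} (hp : 1 ≤ p) {f : ℝ → E}
    (hfm : Measurable f) (hfl : LocInt p f) (t : ℝ) {ε : ℝ} (hε : 0 < ε) :
    ∃ δ > 0, ∀ t' : ℝ, |t' - t| < δ →
      (∫ s in (0:ℝ)..1, dist (f (t' + s)) (f (t + s)) ^ p) ^ (1 / p) < ε := by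
  have hp0 : 0 < p := one_pos.trans_le hp
  obtain ⟨F, hF, hFdist⟩ := hfm.exists_stronglyMeasurable_dist_eq
  set I : Set ℝ := Set.Ioc (t - 1) (t + 2)
  set g : ℝ → lp (fun _ : ℕ ↦ ℝ) ⊤ := I.indicator fun x ↦ F x - F 0
  have hg : MemLp g (ENNReal.ofReal p) volume := by
    have hsub : StronglyMeasurable fun x ↦ F x - F 0 := hF.sub stronglyMeasurable_const
    rw [memLp_indicator_iff_restrict measurableSet_Ioc, ← integrable_norm_rpow_iff
      hsub.aestronglyMeasurable (by simpa using hp0) ENNReal.ofReal_ne_top,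
      ENNReal.toReal_ofReal hp0.le]
    simpa only [← dist_eq_norm, hFdist, IntegrableOn] using (hfl (f 0) (t - 1) (t + 2)).1
  have hlim := (hg.tendsto_integral_norm_translate_sub hp).eventually_lt_const
    (Real.rpow_pos_of_pos hε p)
  obtain ⟨δ, hδ, hlt⟩ := Metric.eventually_nhds_iff.1 hlim
  refine ⟨min δ 1, by positivity, fun t' ht' ↦ ?_⟩
  have ht'δ := ht'.trans_le (min_le_left δ 1)
  have ht'1 := abs_lt.1 (ht'.trans_le (min_le_right δ 1))
  have hnonneg : 0 ≤ ∫ s in (0:ℝ)..1, dist (f (t' + s)) (f (t + s)) ^ p :=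
    intervalIntegral.integral_nonneg zero_le_one fun s _ ↦ by positivity
  rw [one_div, Real.rpow_inv_lt_iff_of_pos hnonneg hε.le hp0]
  refine lt_of_le_of_lt ?_ (hlt (y := t' - t) (by simpa using ht'δ))
  have hint : Integrable (fun x ↦ ‖g (x + (t' - t)) - g x‖ ^ p) := by
    have hsub := ((hg.comp_measurePreserving
      (measurePreserving_add_right volume (t' - t))).sub hg).integrable_norm_rpow
      (by simpa using hp0) ENNReal.ofReal_ne_top
    rwa [ENNReal.toReal_ofReal hp0.le] at hsub
  calc ∫ s in (0:ℝ)..1, dist (f (t' + s)) (f (t + s)) ^ p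
      = ∫ s in (0:ℝ)..1, ‖g (t + s + (t' - t)) - g (t + s)‖ ^ p := by
        refine intervalIntegral.integral_congr fun s hs ↦ ?_
        rw [Set.uIcc_of_le zero_le_one] at hs
        have h₁ : t + s ∈ I := ⟨by linarith [hs.1], by linarith [hs.2]⟩
        have h₂ : t' + s ∈ I := ⟨by linarith [hs.1], by linarith [hs.2]⟩
        simp only [g, show t + s + (t' - t) = t' + s by ring, Set.indicator_of_mem h₁,
          Set.indicator_of_mem h₂, sub_sub_sub_cancel_right, ← dist_eq_norm, hFdist]
    _ = ∫ x in t..t + 1, ‖g (x + (t' - t)) - g x‖ ^ p := by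
        simp [intervalIntegral.integral_comp_add_left
          (fun x ↦ ‖g (x + (t' - t)) - g x‖ ^ p)]
    _ ≤ ∫ x, ‖g (x + (t' - t)) - g x‖ ^ p := by
        rw [intervalIntegral.integral_of_le (by simp)]
        exact setIntegral_le_integral hint (.of_forall fun x ↦ by positivity)

/-- `f` is `S^p`-almost periodic iff its Bochner transform
`f^b : ℝ → L^p((0,1); E)`, `f^b(t) = f(t+·)`, is Bohr almost periodic with respect to the
`L^p` metric `D_{L^p}(u,v) = (∫_0^1 d(u(s),v(s))^p ds)^{1/p}`; Bohr almost periodicity of `f^b`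
is expressed as continuity of `f^b` for this metric together with relative density, for every
`ε > 0`, of the set of `τ` with `sup_t D_{L^p}(f^b(t+τ), f^b(t)) < ε`. -/
theorem stmt0 {E : Type*} [MetricSpace E] [CompleteSpace E]
    [MeasurableSpace E] [OpensMeasurableSpace E]
    (p : ℝ) (hp : 1 ≤ p) (f : ℝ → E) (hfm : Measurable f) (hfl : LocInt p f) :
    SpAP p f ↔
      ((∀ (t : ℝ), ∀ ε > 0, ∃ δ > 0, ∀ t' : ℝ, |t' - t| < δ →
          (∫ s in (0:ℝ)..1, dist (f (t' + s)) (f (t + s)) ^ p) ^ (1 / p) < ε) ∧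
       (∀ ε > 0, RelDense {τ : ℝ | ∃ c, c < ε ∧ ∀ t : ℝ,
          (∫ s in (0:ℝ)..1, dist (f (t + τ + s)) (f (t + s)) ^ p) ^ (1 / p) ≤ c})) := by
  have hshift : ∀ τ t : ℝ, ∫ s in (0:ℝ)..1, dist (f (t + τ + s)) (f (t + s)) ^ p =
      ∫ x in t..(t + 1), dist (f (x + τ)) (f x) ^ p := fun τ t ↦ by
    simpa [add_right_comm] using
      intervalIntegral.integral_comp_add_left (fun x ↦ dist (f (x + τ)) (f x) ^ p) t
        (a := 0) (b := 1)
  simp only [hshift]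
  constructor
  · intro h
    refine ⟨fun t ε hε ↦ exists_forall_integral_dist_translate_lt hp hfm hfl t hε, fun ε hε ↦ ?_⟩
    refine (h (ε / 2) (half_pos hε)).mono ?_
    exact fun τ hτ ↦ ⟨ε / 2, half_lt_self hε, hτ⟩
  · rintro ⟨-, h⟩ ε hε
    refine (h ε hε).mono ?_
    exact fun τ ⟨c, hc, hτ⟩ x ↦ (hτ x).trans hc.le
end

section
/- Let (E,d) be a complete metric space and p, q, r ≥ 1 with 1/p = 1/q + 1/r. Let f : ℝ × E → E be such that f(·,x) is S^p-almost periodic for every x ∈ E, and suppose there exists a nonnegative S^r-bounded function L : ℝ → ℝ such that d(f(t,u), f(t,v)) ≤ L(t)·d(u,v) for all t ∈ ℝ and u, v ∈ E. Then for every S^q-almost periodic function u : ℝ → E, the function t ↦ f(t, u(t)) is S^p-almost periodic. -/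
open MeasureTheory Filter Topology

open scoped ENNReal

theorem exists_not_measurableSet_real : ∃ s : Set ℝ, ¬ MeasurableSet s := by
  by_contra! h
  have h1 : Cardinal.mk {t : Set ℝ | MeasurableSet t} ≤ Cardinal.continuum := by
    have := MeasurableSpace.cardinal_measurableSet_le_continuum
      (s := MeasurableSpace.countableGeneratingSet ℝ)
      ((MeasurableSpace.countable_countableGeneratingSet (α := ℝ)).le_aleph0.trans
        Cardinal.aleph0_le_continuum)
    rwa [MeasurableSpace.generateFrom_countableGeneratingSet] at this
  have h2 : {t : Set ℝ | MeasurableSet t} = Set.univ := Set.eq_univ_of_forall h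
  rw [h2, Cardinal.mk_univ, Cardinal.mk_set, Cardinal.mk_real] at h1
  exact (Cardinal.cantor _).not_ge h1

theorem MeasurableSet.exists_subset_not_measurableSet {X : Type*} [MeasurableSpace X]
    [StandardBorelSpace X] {P : Set X} (hP : MeasurableSet P) (hc : ¬ P.Countable) :
    ∃ T ⊆ P, ¬ MeasurableSet T := by
  by_contra! h
  obtain ⟨s, hs⟩ := exists_not_measurableSet_real
  have : StandardBorelSpace P := hP.standardBorel
  have e : P ≃ᵐ ℝ := PolishSpace.measurableEquivOfNotCountable
    (by rwa [Set.countable_coe_iff]) not_countable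
  apply hs
  rw [← e.measurableSet_preimage]
  have := h (Subtype.val '' (e ⁻¹' s)) (by simp)
  rwa [(MeasurableEmbedding.subtype_coe hP).measurableSet_image] at this

/-- A measurable map from a standard Borel space to a metric space has separable range. -/
theorem isSeparable_range_of_measurable {X E : Type*} [MeasurableSpace X] [StandardBorelSpace X]
    [PseudoMetricSpace E] [MeasurableSpace E] [OpensMeasurableSpace E] {u : X → E}
    (hu : Measurable u) : TopologicalSpace.IsSeparable (Set.range u) := by
  suffices H : ∀ ε > 0, ∃ P : Set X, P.Countable ∧ ∀ x, ∃ y ∈ P, dist (u x) (u y) < ε by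
    obtain ⟨t, -, htc, ht⟩ := EMetric.subset_countable_closure_of_almost_dense_set (Set.range u)
      (fun ε hε => by
        obtain ⟨δ, -, hδ, hδε⟩ := ENNReal.lt_iff_exists_real_btwn.1 hε
        obtain ⟨P, hPc, hP⟩ := H δ (ENNReal.ofReal_pos.1 hδ)
        refine ⟨u '' P, hPc.image u, ?_⟩
        rintro _ ⟨x, rfl⟩
        obtain ⟨y, hy, hxy⟩ := hP x
        simp only [Set.mem_iUnion]
        refine ⟨u y, ⟨y, hy, rfl⟩, ?_⟩
        rw [Metric.mem_closedEBall, edist_dist]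
        exact (ENNReal.ofReal_le_ofReal hxy.le).trans hδε.le)
    exact ⟨t, htc, ht⟩
  intro ε hε
  obtain ⟨P, hP⟩ := zorn_subset {P : Set X | P.Pairwise fun x y => ε ≤ dist (u x) (u y)} (by
    intro c hc hchain
    refine ⟨⋃₀ c, ?_, fun s hs => Set.subset_sUnion_of_mem hs⟩
    exact (Set.pairwise_sUnion hchain.directedOn).2 hc)
  have hsep := hP.prop
  have hunique : ∀ {x y z}, y ∈ P → z ∈ P → dist (u x) (u y) < ε / 2 → dist (u x) (u z) < ε / 2 →
      y = z := by
    intro x y z hy hz hxy hxz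
    by_contra hne
    have := hsep hy hz hne
    have := dist_triangle_left (u y) (u z) (u x)
    linarith
  refine ⟨P, ?_, fun x => ?_⟩
  · let U : Set X → Set X := fun T => u ⁻¹' ⋃ y ∈ T, Metric.ball (u y) (ε / 2)
    have hU : ∀ T, MeasurableSet (U T) := fun T =>
      hu (isOpen_biUnion fun _ _ => Metric.isOpen_ball).measurableSet
    have mem_U : ∀ {T x}, x ∈ U T ↔ ∃ y ∈ T, dist (u x) (u y) < ε / 2 := by
      intro T x
      simp [U]
    classical
    let g : X → X := fun x => if h : ∃ y ∈ P, dist (u x) (u y) < ε / 2 then h.choose else x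
    have hgU : ∀ {x}, x ∈ U P → g x ∈ P ∧ dist (u x) (u (g x)) < ε / 2 := by
      intro x hx
      have h := mem_U.1 hx
      simp only [g, dif_pos h]
      exact h.choose_spec
    have hgU' : ∀ {x}, x ∉ U P → g x = x := by
      intro x hx
      have h := fun h => hx (mem_U.2 h)
      simp only [g, dif_neg h]
    have hg : Measurable g := by
      intro A hA
      have : g ⁻¹' A = U (A ∩ P) ∪ ((U P)ᶜ ∩ A) := by
        ext x
        by_cases hx : x ∈ U P
        · simp only [Set.mem_preimage, Set.mem_union, Set.mem_inter_iff, Set.mem_compl_iff, hx,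
            not_true, false_and, or_false, mem_U]
          constructor
          · exact fun h => ⟨g x, ⟨h, (hgU hx).1⟩, (hgU hx).2⟩
          · rintro ⟨y, ⟨hyA, hyP⟩, hxy⟩
            rwa [hunique (hgU hx).1 hyP (hgU hx).2 hxy]
        · have : x ∉ U (A ∩ P) := fun h => by
            obtain ⟨y, hy, hxy⟩ := mem_U.1 h
            exact hx (mem_U.2 ⟨y, hy.2, hxy⟩)
          simp [hx, this, hgU' hx]
      rw [this]
      exact (hU _).union ((hU _).compl.inter hA)
    have hself : ∀ {T}, T ⊆ U T := fun {T} x hx => mem_U.2 ⟨x, hx, by simpa using half_pos hε⟩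
    have hPm : MeasurableSet P := by
      have : P = U P ∩ {x | g x = x} := by
        ext x
        constructor
        · intro hx
          have := hgU (hself hx)
          exact ⟨hself hx, hunique this.1 hx this.2 (by simpa using half_pos hε)⟩
        · rintro ⟨hx, hgx⟩
          have := (hgU hx).1
          rwa [hgx] at this
      rw [this]
      let := upgradeStandardBorel X
      exact (hU P).inter (measurableSet_eq_fun hg measurable_id)
    by_contra hc
    obtain ⟨T, hTP, hT⟩ := hPm.exists_subset_not_measurableSet hc
    apply hT
    have : T = U T ∩ P := by
      ext x
      constructor
      · exact fun hx => ⟨hself hx, hTP hx⟩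
      · rintro ⟨hx, hxP⟩
        obtain ⟨y, hy, hxy⟩ := mem_U.1 hx
        rwa [hunique hxP (hTP hy) (by simpa using half_pos hε) hxy]
    rw [this]
    exact (hU T).inter hPm
  · by_contra! h
    have hins : insert x P ∈ {P : Set X | P.Pairwise fun x y => ε ≤ dist (u x) (u y)} := by
      refine hsep.insert fun y hy _ => ⟨h y hy, ?_⟩
      rw [dist_comm]
      exact h y hy
    have := h x (hP.le_of_ge hins (Set.subset_insert x P) (Set.mem_insert x P))
    simp at this
    linarith

theorem stronglyMeasurable_of_standardBorel {X E : Type*} [MeasurableSpace X]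
    [StandardBorelSpace X] [PseudoMetricSpace E] [MeasurableSpace E] [OpensMeasurableSpace E]
    {u : X → E} (hu : Measurable u) : StronglyMeasurable u := by
  have hsep := isSeparable_range_of_measurable hu
  have hb : Measurable[_, borel E] u := hu.mono le_rfl OpensMeasurableSpace.borel_le
  let _ : MeasurableSpace E := borel E
  have : BorelSpace E := ⟨rfl⟩
  exact stronglyMeasurable_iff_measurable_separable.2 ⟨hb, hsep⟩

/-- A property `R` of real numbers is finitely coloured if `ℝ` splits into finitely many classes
such that all differences within a class satisfy `R`. -/
def FinCol (R : ℝ → Prop) : Prop :=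
  ∃ (κ : Type) (_ : Finite κ) (c : ℝ → κ), ∀ τ σ, c τ = c σ → R (τ - σ)

theorem FinCol.and {R S : ℝ → Prop} (hR : FinCol R) (hS : FinCol S) :
    FinCol fun τ => R τ ∧ S τ := by
  obtain ⟨κ, _, c, hc⟩ := hR
  obtain ⟨κ', _, c', hc'⟩ := hS
  refine ⟨κ × κ', inferInstance, fun τ => (c τ, c' τ), fun τ σ h => ?_⟩
  exact ⟨hc _ _ (Prod.ext_iff.1 h).1, hc' _ _ (Prod.ext_iff.1 h).2⟩

theorem FinCol.forall_mem {ι : Type*} {s : Set ι} (hs : s.Finite) {R : ι → ℝ → Prop}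
    (hR : ∀ i ∈ s, FinCol (R i)) : FinCol fun τ => ∀ i ∈ s, R i τ := by
  induction s, hs using Set.Finite.induction_on with
  | empty => exact ⟨Unit, inferInstance, fun _ => (), by simp⟩
  | @insert a s _ _ ih =>
    have := (hR a (Set.mem_insert a s)).and
      (ih fun i hi => hR i (Set.mem_insert_of_mem a hi))
    simpa [Set.forall_mem_insert] using this

theorem FinCol.relDense {R : ℝ → Prop} (hR : FinCol R) : RelDense {τ | R τ} := by
  obtain ⟨κ, _, c, hc⟩ := hR
  have key : ∀ k : κ, ∃ r : ℝ, ∀ τ, c τ = k → c r = k := fun k => by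
    by_cases h : ∃ τ, c τ = k
    · exact ⟨h.choose, fun _ _ => h.choose_spec⟩
    · exact ⟨0, fun τ hτ => absurd ⟨τ, hτ⟩ h⟩
  choose r hr using key
  obtain ⟨M, hM⟩ := (Set.finite_range fun k => |r k|).bddAbove
  have hM' : ∀ k, |r k| ≤ M := fun k => hM ⟨k, rfl⟩
  have hM0 : 0 ≤ M := (abs_nonneg _).trans (hM' (c 0))
  refine ⟨2 * M + 1, by positivity, fun a => ⟨a + M - r (c (a + M)), ?_, ?_⟩⟩
  · exact hc _ _ (hr _ _ rfl).symm
  · have := abs_le.1 (hM' (c (a + M)))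
    constructor <;> linarith

theorem FinCol.of_bounded_remainder {S R : ℝ → Prop} {l δ : ℝ} (hδ : 0 < δ)
    (hS : ∀ τ, ∃ s ∈ Set.Icc 0 l, S (τ - s))
    (h : ∀ τ σ s, S τ → S σ → |s| < δ → R (τ - σ + s)) : FinCol R := by
  choose s hs hSs using hS
  refine ⟨Set.Icc (0 : ℤ) ⌊l / δ⌋, inferInstance, fun τ => ⟨⌊s τ / δ⌋, ?_, ?_⟩, fun τ σ hτσ => ?_⟩
  · exact Int.floor_nonneg.2 (div_nonneg (hs τ).1 hδ.le)
  · exact Int.floor_le_floor (div_le_div_of_nonneg_right (hs τ).2 hδ.le)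
  · have h1 : |s τ / δ - s σ / δ| < 1 := Int.abs_sub_lt_one_of_floor_eq_floor (Subtype.ext_iff.1 hτσ)
    rw [← sub_div, abs_div, abs_of_pos hδ, div_lt_one hδ] at h1
    have := h _ _ (s τ - s σ) (hSs τ) (hSs σ) h1
    rwa [show τ - s τ - (σ - s σ) + (s τ - s σ) = τ - σ by ring] at this

/-- The `L^p` seminorm over the unit window starting at `x`. -/
noncomputable def windowNorm (p : ℝ) (g : ℝ → ℝ) (x : ℝ) : ℝ≥0∞ :=
  eLpNorm g (ENNReal.ofReal p) (volume.restrict (Set.Ioc x (x + 1)))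

section WindowNorm

variable {p : ℝ} {g h : ℝ → ℝ}

theorem windowNorm_add_le (hp : 1 ≤ p) (hg : AEStronglyMeasurable g volume)
    (hh : AEStronglyMeasurable h volume) (x : ℝ) :
    windowNorm p (fun t => g t + h t) x ≤ windowNorm p g x + windowNorm p h x :=
  eLpNorm_add_le hg.restrict hh.restrict (by simpa using hp)

theorem windowNorm_mono (hgh : ∀ t, |g t| ≤ h t) (x : ℝ) :
    windowNorm p g x ≤ windowNorm p h x :=
  eLpNorm_mono_real hgh

theorem windowNorm_sum_le (hp : 1 ≤ p) {ι : Type*} (s : Finset ι) {g : ι → ℝ → ℝ}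
    (hg : ∀ i ∈ s, AEStronglyMeasurable (g i) volume) (x : ℝ) :
    windowNorm p (fun t => ∑ i ∈ s, g i t) x ≤ ∑ i ∈ s, windowNorm p (g i) x := by
  have hs : (fun t => ∑ i ∈ s, g i t) = ∑ i ∈ s, g i := by
    ext t
    simp
  rw [windowNorm, hs]
  exact eLpNorm_sum_le (fun i hi => (hg i hi).restrict) (by simpa using hp)

theorem windowNorm_comp_add (hg : AEStronglyMeasurable g volume) (τ x : ℝ) :
    windowNorm p (fun t => g (t + τ)) x = windowNorm p g (x + τ) := by
  have h := (measurePreserving_add_right (volume : Measure ℝ) τ).restrict_preimage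
    (measurableSet_Ioc (a := x + τ) (b := x + τ + 1))
  have hpre : (· + τ) ⁻¹' Set.Ioc (x + τ) (x + τ + 1) = Set.Ioc x (x + 1) := by
    rw [Set.preimage_add_const_Ioc]
    congr 1 <;> ring
  rw [hpre] at h
  exact eLpNorm_comp_measurePreserving hg.restrict h

theorem windowNorm_le_eLpNorm {a b x : ℝ} (ha : a ≤ x) (hb : x + 1 ≤ b) :
    windowNorm p g x ≤ eLpNorm g (ENNReal.ofReal p) (volume.restrict (Set.Ioc a b)) :=
  eLpNorm_mono_measure _ (Measure.restrict_mono (Set.Ioc_subset_Ioc ha hb) le_rfl)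

theorem windowNorm_mul_le {q r : ℝ} (hp : 1 ≤ p) (hq : 1 ≤ q) (hr : 1 ≤ r)
    (hpqr : 1 / p = 1 / q + 1 / r) (hg : AEStronglyMeasurable g volume)
    (hh : AEStronglyMeasurable h volume) (x : ℝ) :
    windowNorm p (fun t => g t * h t) x ≤ windowNorm r g x * windowNorm q h x := by
  have : ENNReal.HolderTriple (ENNReal.ofReal r) (ENNReal.ofReal q) (ENNReal.ofReal p) := by
    constructor
    rw [← ENNReal.ofReal_inv_of_pos (by linarith), ← ENNReal.ofReal_inv_of_pos (by linarith),
      ← ENNReal.ofReal_inv_of_pos (by linarith), ← ENNReal.ofReal_add (by positivity) (by positivity)]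
    congr 1
    simpa [add_comm] using hpqr.symm
  have := eLpNorm_smul_le_mul_eLpNorm (p := ENNReal.ofReal r) (q := ENNReal.ofReal q)
    (r := ENNReal.ofReal p) (hh.restrict (s := Set.Ioc x (x + 1))) hg.restrict
  exact this

theorem aestronglyMeasurable_of_rpow {α : Type*} [MeasurableSpace α] {μ : Measure α} {g : α → ℝ}
    (hp : p ≠ 0) (hg : ∀ t, 0 ≤ g t) (h : AEStronglyMeasurable (fun t => g t ^ p) μ) :
    AEStronglyMeasurable g μ := by
  have : g = fun t => (g t ^ p) ^ p⁻¹ := by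
    ext t
    rw [Real.rpow_rpow_inv (hg t) hp]
  rw [this]
  exact (h.aemeasurable.pow_const _).aestronglyMeasurable

theorem memLp_of_intervalIntegrable (hp : 1 ≤ p) (hg : ∀ t, 0 ≤ g t) {a b : ℝ} (hab : a ≤ b)
    (h : IntervalIntegrable (fun t => g t ^ p) volume a b) :
    MemLp g (ENNReal.ofReal p) (volume.restrict (Set.Ioc a b)) := by
  have h1 : Integrable (fun t => g t ^ p) (volume.restrict (Set.Ioc a b)) :=
    (intervalIntegrable_iff_integrableOn_Ioc_of_le hab).1 h
  rw [← integrable_norm_rpow_iff (aestronglyMeasurable_of_rpow (by linarith) hg h1.1)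
    (by simp; linarith) ENNReal.ofReal_ne_top, ENNReal.toReal_ofReal (by linarith)]
  simpa [abs_of_nonneg (hg _)] using h1

theorem windowNorm_eq_of_memLp (hp : 1 ≤ p) (hg : ∀ t, 0 ≤ g t) {x : ℝ}
    (h : MemLp g (ENNReal.ofReal p) (volume.restrict (Set.Ioc x (x + 1)))) :
    windowNorm p g x = ENNReal.ofReal ((∫ t in x..(x + 1), g t ^ p) ^ (1 / p)) := by
  rw [windowNorm, h.eLpNorm_eq_integral_rpow_norm (by simp; linarith) ENNReal.ofReal_ne_top,
    ENNReal.toReal_ofReal (by linarith), intervalIntegral.integral_of_le (by linarith), one_div]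
  simp [abs_of_nonneg (hg _)]

theorem integral_rpow_le_of_windowNorm_le (hp : 1 ≤ p) (hg : ∀ t, 0 ≤ g t) {x ε : ℝ} (hε : 0 ≤ ε)
    (h : windowNorm p g x ≤ ENNReal.ofReal ε) :
    (∫ t in x..(x + 1), g t ^ p) ^ (1 / p) ≤ ε := by
  by_cases hi : IntervalIntegrable (fun t => g t ^ p) volume x (x + 1)
  · rw [windowNorm_eq_of_memLp hp hg (memLp_of_intervalIntegrable hp hg (by linarith) hi)] at h
    exact (ENNReal.ofReal_le_ofReal_iff hε).1 h
  · rwa [intervalIntegral.integral_undef hi, Real.zero_rpow (by positivity)]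

/-- Translation is continuous in `L^p` over bounded intervals. -/
theorem eventually_eLpNorm_translate_sub_le (hp : 1 ≤ p) (a b : ℝ)
    (hg : ∀ a b, MemLp g (ENNReal.ofReal p) (volume.restrict (Set.Ioc a b)))
    {ε : ℝ≥0∞} (hε : ε ≠ 0) :
    ∀ᶠ s in 𝓝 (0 : ℝ), eLpNorm (fun t => g (t + s) - g t) (ENNReal.ofReal p)
      (volume.restrict (Set.Ioc a b)) ≤ ε := by
  have : Fact (1 ≤ ENNReal.ofReal p) := ⟨by simpa using hp⟩
  have : Fact (ENNReal.ofReal p ≠ ∞) := ⟨ENNReal.ofReal_ne_top⟩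
  let k : ℝ → ℝ := (Set.Ioc (a - 1) (b + 1)).indicator g
  have hk : MemLp k (ENNReal.ofReal p) volume :=
    (memLp_indicator_iff_restrict measurableSet_Ioc).2 (hg _ _)
  have hcont : Continuous fun s : ℝ => DomAddAct.mk s +ᵥ hk.toLp k := by fun_prop
  have ht : ∀ᶠ s in 𝓝 (0 : ℝ), edist (DomAddAct.mk s +ᵥ hk.toLp k) (hk.toLp k) < ε := by
    have h0 := (hcont.edist (continuous_const (y := hk.toLp k))).tendsto 0
    simp only [DomAddAct.mk_zero, zero_vadd, edist_self] at h0
    exact h0.eventually_lt_const (pos_iff_ne_zero.2 hε)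
  filter_upwards [ht, Metric.ball_mem_nhds (0 : ℝ) one_pos] with s hs1 hs
  have hs2 : |s| < 1 := by simpa using hs
  rw [abs_lt] at hs2
  rw [DomAddAct.mk_vadd_toLp, Lp.edist_toLp_toLp] at hs1
  refine le_trans ?_ hs1.le
  calc _ = eLpNorm (fun t => k (t + s) - k t) (ENNReal.ofReal p)
        (volume.restrict (Set.Ioc a b)) := by
        refine eLpNorm_congr_ae ?_
        filter_upwards [ae_restrict_mem measurableSet_Ioc] with t ht
        have h1 : t ∈ Set.Ioc (a - 1) (b + 1) := ⟨by linarith [ht.1], by linarith [ht.2]⟩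
        have h2 : t + s ∈ Set.Ioc (a - 1) (b + 1) := ⟨by linarith [ht.1], by linarith [ht.2]⟩
        simp only [k, Set.indicator_of_mem h1, Set.indicator_of_mem h2]
    _ ≤ _ := by
        refine (eLpNorm_mono_measure _ Measure.restrict_le_self).trans (le_of_eq ?_)
        congr 1
        ext t
        simp [add_comm]

end WindowNorm

theorem tendsto_eLpNorm_zero_of_dominated {α : Type*} [MeasurableSpace α] {μ : Measure α}
    {p : ℝ≥0∞} (hp0 : p ≠ 0) (hp : p ≠ ∞) {F : ℕ → α → ℝ} {bound : α → ℝ}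
    (hF : ∀ n, AEStronglyMeasurable (F n) μ) (hb : MemLp bound p μ)
    (hle : ∀ n t, |F n t| ≤ bound t) (hlim : ∀ t, Tendsto (F · t) atTop (𝓝 0)) :
    Tendsto (fun n => eLpNorm (F n) p μ) atTop (𝓝 0) := by
  have hp' := ENNReal.toReal_pos hp0 hp
  have key : Tendsto (fun n => ∫⁻ t, ‖F n t‖ₑ ^ p.toReal ∂μ) atTop (𝓝 (∫⁻ _, 0 ∂μ)) := by
    refine tendsto_lintegral_of_dominated_convergence' (fun t => ‖bound t‖ₑ ^ p.toReal)
      (fun n => (hF n).enorm.pow_const _) (fun n => .of_forall fun t => ?_) ?_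
      (.of_forall fun t => ?_)
    · refine ENNReal.rpow_le_rpow (enorm_le_iff_norm_le.2 ?_) hp'.le
      exact (hle n t).trans (le_abs_self _)
    · exact (lintegral_rpow_enorm_lt_top_of_eLpNorm_lt_top hp0 hp hb.2).ne
    · have := ((hlim t).enorm).ennrpow_const p.toReal
      simpa [hp'] using this
  have := key.ennrpow_const (1 / p.toReal)
  simp_rw [eLpNorm_eq_lintegral_rpow_enorm_toReal hp0 hp]
  simpa [hp'] using this

section Stepanov

variable {E : Type*} [PseudoMetricSpace E] {p : ℝ} {f : ℝ → E}

/-- `τ` is an `ε`-almost period of `f` for the Stepanov distance of order `p`. -/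
def StepanovPeriod (p : ℝ) (f : ℝ → E) (ε : ℝ≥0∞) (τ : ℝ) : Prop :=
  ∀ x, windowNorm p (fun t => dist (f (t + τ)) (f t)) x ≤ ε

theorem stronglyMeasurable_dist_translate (hf : StronglyMeasurable f) (τ : ℝ) :
    StronglyMeasurable fun t => dist (f (t + τ)) (f t) :=
  (hf.comp_measurable (measurable_add_const τ)).dist hf

theorem LocInt.memLp_dist_const (hp : 1 ≤ p) (hl : LocInt p f) (z : E) (a b : ℝ) :
    MemLp (fun t => dist (f t) z) (ENNReal.ofReal p) (volume.restrict (Set.Ioc a b)) :=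
  (memLp_of_intervalIntegrable hp (fun _ => dist_nonneg) (le_max_left a b) (hl z _ _)).mono_measure
    (Measure.restrict_mono (Set.Ioc_subset_Ioc_right (le_max_right a b)) le_rfl)

theorem LocInt.translate (hl : LocInt p f) (τ : ℝ) : LocInt p fun t => f (t + τ) := by
  intro z a b
  simpa using (hl z (a + τ) (b + τ)).comp_add_right τ

theorem LocInt.memLp_dist_translate (hp : 1 ≤ p) (hf : StronglyMeasurable f) (hl : LocInt p f)
    (τ a b : ℝ) :
    MemLp (fun t => dist (f (t + τ)) (f t)) (ENNReal.ofReal p)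
      (volume.restrict (Set.Ioc a b)) := by
  refine (((hl.translate τ).memLp_dist_const hp (f 0) a b).add
    (hl.memLp_dist_const hp (f 0) a b)).mono'
    (stronglyMeasurable_dist_translate hf τ).aestronglyMeasurable (.of_forall fun t => ?_)
  simpa using dist_triangle_right _ _ _

theorem SpAP.relDense_stepanovPeriod (hp : 1 ≤ p) (hf : StronglyMeasurable f) (hl : LocInt p f)
    (hap : SpAP p f) {ε : ℝ≥0∞} (hε : ε ≠ 0) : RelDense {τ | StepanovPeriod p f ε τ} := by
  obtain ⟨δ, -, hδ, hδε⟩ := ENNReal.lt_iff_exists_real_btwn.1 (pos_iff_ne_zero.2 hε)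
  obtain ⟨l, hl0, h⟩ := hap δ (ENNReal.ofReal_pos.1 hδ)
  refine ⟨l, hl0, fun a => ?_⟩
  obtain ⟨τ, hτ, hτa⟩ := h a
  refine ⟨τ, fun x => ?_, hτa⟩
  rw [windowNorm_eq_of_memLp hp (fun _ => dist_nonneg) (hl.memLp_dist_translate hp hf τ _ _)]
  exact (ENNReal.ofReal_le_ofReal (hτ x)).trans hδε.le

theorem spAP_of_relDense_stepanovPeriod (hp : 1 ≤ p)
    (h : ∀ ε > 0, RelDense {τ | StepanovPeriod p f (ENNReal.ofReal ε) τ}) : SpAP p f := by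
  intro ε hε
  obtain ⟨l, hl0, h⟩ := h ε hε
  refine ⟨l, hl0, fun a => ?_⟩
  obtain ⟨τ, hτ, hτa⟩ := h a
  exact ⟨τ, fun x => integral_rpow_le_of_windowNorm_le hp (fun _ => dist_nonneg) hε.le (hτ x), hτa⟩

theorem StepanovPeriod.add (hp : 1 ≤ p) (hf : StronglyMeasurable f) {ε η : ℝ≥0∞} {τ σ : ℝ}
    (hτ : StepanovPeriod p f ε τ) (hσ : StepanovPeriod p f η σ) :
    StepanovPeriod p f (ε + η) (τ + σ) := by
  intro x
  have hm := fun τ => (stronglyMeasurable_dist_translate hf τ).aestronglyMeasurable (μ := volume)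
  have h1 : windowNorm p (fun t => dist (f (t + σ + τ)) (f (t + σ))) x ≤ ε := by
    rw [windowNorm_comp_add (g := fun t => dist (f (t + τ)) (f t)) (hm τ)]
    exact hτ _
  have hm' : AEStronglyMeasurable (fun t => dist (f (t + σ + τ)) (f (t + σ))) volume :=
    ((stronglyMeasurable_dist_translate hf τ).comp_measurable
      (measurable_add_const σ)).aestronglyMeasurable
  refine le_trans (windowNorm_mono (fun t => ?_) x)
    ((windowNorm_add_le hp hm' (hm σ) x).trans (add_le_add h1 (hσ x)))
  rw [abs_of_nonneg dist_nonneg, show t + (τ + σ) = t + σ + τ by ring]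
  exact dist_triangle _ _ _

theorem StepanovPeriod.neg (hf : StronglyMeasurable f) {ε : ℝ≥0∞} {τ : ℝ}
    (hτ : StepanovPeriod p f ε τ) : StepanovPeriod p f ε (-τ) := by
  intro x
  have := windowNorm_comp_add (p := p)
    (stronglyMeasurable_dist_translate hf τ).aestronglyMeasurable (-τ) x
  simp only [neg_add_cancel_right, dist_comm (f _) (f (_ + -τ))] at this
  rw [this]
  exact hτ _

theorem SpAP.exists_shift (hp : 1 ≤ p) (hf : StronglyMeasurable f) (hl : LocInt p f)
    (hap : SpAP p f) {ε : ℝ≥0∞} (hε : ε ≠ 0) :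
    ∃ l > 0, ∀ x, ∃ τ, StepanovPeriod p f ε τ ∧ x + τ ∈ Set.Icc 0 l := by
  obtain ⟨l, hl0, h⟩ := hap.relDense_stepanovPeriod hp hf hl hε
  refine ⟨l, hl0, fun x => ?_⟩
  obtain ⟨τ, hτ, hτx⟩ := h (-x)
  exact ⟨τ, hτ, by linarith [hτx.1], by linarith [hτx.2]⟩

theorem exists_finset_eLpNorm_infDist_le (hp : 1 ≤ p) (hf : StronglyMeasurable f)
    (hl : LocInt p f) (a b : ℝ) {ε : ℝ≥0∞} (hε : ε ≠ 0) :
    ∃ K : Finset E, K.Nonempty ∧ eLpNorm (fun t => Metric.infDist (f t) K) (ENNReal.ofReal p)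
      (volume.restrict (Set.Ioc a b)) ≤ ε := by
  obtain ⟨c, hc, hfc⟩ := hf.isSeparable_range
  have hne : c.Nonempty := closure_nonempty_iff.1 ⟨f 0, hfc ⟨0, rfl⟩⟩
  obtain ⟨z, rfl⟩ := hc.exists_eq_range hne
  classical
  let K : ℕ → Finset E := fun n => (Finset.range (n + 1)).image z
  have hzK : ∀ {i n}, i ≤ n → z i ∈ (K n : Set E) := fun {i n} hin =>
    Finset.mem_coe.2 (Finset.mem_image_of_mem z (Finset.mem_range.2 (by omega)))
  have hlim : Tendsto (fun n => eLpNorm (fun t => Metric.infDist (f t) (K n)) (ENNReal.ofReal p)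
      (volume.restrict (Set.Ioc a b))) atTop (𝓝 0) := by
    refine tendsto_eLpNorm_zero_of_dominated (by simp; linarith) ENNReal.ofReal_ne_top
      (fun n => ((Metric.continuous_infDist_pt _).comp_stronglyMeasurable hf).aestronglyMeasurable)
      (hl.memLp_dist_const hp (z 0) a b) (fun n t => ?_) (fun t => ?_)
    · rw [abs_of_nonneg Metric.infDist_nonneg]
      exact Metric.infDist_le_dist_of_mem (hzK (Nat.zero_le n))
    · rw [Metric.tendsto_atTop]
      intro δ hδ
      obtain ⟨_, ⟨i, rfl⟩, hi⟩ := Metric.mem_closure_iff.1 (hfc ⟨t, rfl⟩) δ hδ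
      refine ⟨i, fun n hn => ?_⟩
      rw [Real.dist_0_eq_abs, abs_of_nonneg Metric.infDist_nonneg]
      exact (Metric.infDist_le_dist_of_mem (hzK hn)).trans_lt hi
  obtain ⟨n, hn⟩ := (hlim.eventually_lt_const (pos_iff_ne_zero.2 hε)).exists
  exact ⟨K n, ⟨z 0, hzK (Nat.zero_le n)⟩, hn.le⟩

theorem exists_mem_infDist_eq (K : Finset E) (hK : K.Nonempty) (y : E) :
    ∃ z ∈ K, Metric.infDist y K = dist y z :=
  K.finite_toSet.isCompact.exists_infDist_eq_dist hK y

theorem aestronglyMeasurable_infDist (hf : StronglyMeasurable f) (K : Set E) (μ : Measure ℝ) :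
    AEStronglyMeasurable (fun t => Metric.infDist (f t) K) μ :=
  ((Metric.continuous_infDist_pt K).comp_stronglyMeasurable hf).aestronglyMeasurable

/-- The values of a Stepanov almost periodic function are approximated, uniformly in the Stepanov
sense, by a finite set. -/
theorem SpAP.exists_finset_windowNorm_infDist_le (hp : 1 ≤ p) (hf : StronglyMeasurable f)
    (hl : LocInt p f) (hap : SpAP p f) {ε : ℝ≥0∞} (hε : ε ≠ 0) :
    ∃ K : Finset E, K.Nonempty ∧ ∀ x, windowNorm p (fun t => Metric.infDist (f t) K) x ≤ ε := by
  have hε2 : ε / 2 ≠ 0 := by simpa using hε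
  obtain ⟨l, hl0, hshift⟩ := hap.exists_shift hp hf hl hε2
  obtain ⟨K, hK, hKl⟩ := exists_finset_eLpNorm_infDist_le hp hf hl 0 (l + 1) hε2
  refine ⟨K, hK, fun x => ?_⟩
  obtain ⟨τ, hτ, hτx⟩ := hshift x
  have hm := aestronglyMeasurable_infDist hf K volume
  have h1 : windowNorm p (fun t => Metric.infDist (f (t + τ)) K) x ≤ ε / 2 := by
    rw [windowNorm_comp_add (g := fun t => Metric.infDist (f t) K) hm]
    exact (windowNorm_le_eLpNorm hτx.1 (by linarith [hτx.2])).trans hKl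
  refine le_trans (windowNorm_mono (fun t => ?_) x) ((windowNorm_add_le hp
    (aestronglyMeasurable_infDist (hf.comp_measurable (measurable_add_const τ)) K volume)
    (stronglyMeasurable_dist_translate hf τ).aestronglyMeasurable x).trans
    ((add_le_add h1 (hτ x)).trans (ENNReal.add_halves ε).le))
  rw [abs_of_nonneg Metric.infDist_nonneg, dist_comm]
  exact Metric.infDist_le_infDist_add_dist

theorem sum_div_card_le {ι : Type*} (s : Finset ι) (ε : ℝ≥0∞) : ∑ _i ∈ s, ε / s.card ≤ ε := by
  rw [Finset.sum_const, nsmul_eq_mul]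
  exact ENNReal.mul_div_le

theorem eventually_eLpNorm_dist_translate_le (hp : 1 ≤ p) (hf : StronglyMeasurable f)
    (hl : LocInt p f) (a b : ℝ) {ε : ℝ≥0∞} (hε : ε ≠ 0) :
    ∀ᶠ s in 𝓝 (0 : ℝ), eLpNorm (fun t => dist (f (t + s)) (f t)) (ENNReal.ofReal p)
      (volume.restrict (Set.Ioc a b)) ≤ ε := by
  have hε2 : ε / 2 ≠ 0 := by simpa using hε
  have hε4 : ε / 2 / 2 ≠ 0 := by simpa using hε
  obtain ⟨K, hK, hKl⟩ := exists_finset_eLpNorm_infDist_le hp hf hl a b hε4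
  have hp' : 1 ≤ ENNReal.ofReal p := by simpa using hp
  have hmz : ∀ (z : E) (s : ℝ), AEStronglyMeasurable
      (fun t => |dist (f (t + s)) z - dist (f t) z|) (volume.restrict (Set.Ioc a b)) := fun z s =>
    ((((hf.comp_measurable (measurable_add_const s)).dist stronglyMeasurable_const).sub
      (hf.dist stronglyMeasurable_const)).norm).aestronglyMeasurable
  have hmK := aestronglyMeasurable_infDist hf K (volume.restrict (Set.Ioc a b))
  have hev : ∀ᶠ s in 𝓝 (0 : ℝ), ∀ z ∈ K, eLpNorm (fun t => dist (f (t + s)) z - dist (f t) z)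
      (ENNReal.ofReal p) (volume.restrict (Set.Ioc a b)) ≤ ε / 2 / K.card :=
    (Filter.eventually_all_finset K).2 fun z _ =>
      eventually_eLpNorm_translate_sub_le hp a b (fun a b => hl.memLp_dist_const hp z a b)
        (ENNReal.div_ne_zero.2 ⟨hε2, ENNReal.natCast_ne_top _⟩)
  filter_upwards [hev] with s hs
  calc eLpNorm (fun t => dist (f (t + s)) (f t)) (ENNReal.ofReal p)
        (volume.restrict (Set.Ioc a b))
      ≤ eLpNorm ((∑ z ∈ K, fun t => |dist (f (t + s)) z - dist (f t) z|) +
        ((fun t => Metric.infDist (f t) K) + fun t => Metric.infDist (f t) K)) (ENNReal.ofReal p)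
        (volume.restrict (Set.Ioc a b)) := by
        refine eLpNorm_mono_real fun t => ?_
        obtain ⟨z, hz, hzt⟩ := exists_mem_infDist_eq K hK (f t)
        have h1 := Finset.single_le_sum (f := fun z => |dist (f (t + s)) z - dist (f t) z|)
          (fun _ _ => abs_nonneg _) hz
        have h2 := le_abs_self (dist (f (t + s)) z - dist (f t) z)
        have h3 := dist_triangle_right (f (t + s)) (f t) z
        simp only [Pi.add_apply, Finset.sum_apply, hzt, Real.norm_eq_abs, abs_dist]
        linarith
    _ ≤ ∑ z ∈ K, ε / 2 / K.card + (ε / 2 / 2 + ε / 2 / 2) := by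
        refine (eLpNorm_add_le (Finset.aestronglyMeasurable_sum _ fun z _ => hmz z s)
          (hmK.add hmK) hp').trans (add_le_add ?_ ?_)
        · refine (eLpNorm_sum_le (fun z _ => hmz z s) hp').trans (Finset.sum_le_sum fun z hz => ?_)
          exact (eLpNorm_norm fun t => dist (f (t + s)) z - dist (f t) z).trans_le (hs z hz)
        · exact (eLpNorm_add_le hmK hmK hp').trans (add_le_add hKl hKl)
    _ ≤ ε := by
        rw [ENNReal.add_halves]
        exact (add_le_add_left (sum_div_card_le K _) _).trans (ENNReal.add_halves ε).le

theorem SpAP.eventually_stepanovPeriod (hp : 1 ≤ p) (hf : StronglyMeasurable f) (hl : LocInt p f)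
    (hap : SpAP p f) {ε : ℝ≥0∞} (hε : ε ≠ 0) : ∀ᶠ s in 𝓝 (0 : ℝ), StepanovPeriod p f ε s := by
  have hε3 : ε / 3 ≠ 0 := ENNReal.div_ne_zero.2 ⟨hε, by simp⟩
  obtain ⟨l, hl0, hshift⟩ := hap.exists_shift hp hf hl hε3
  filter_upwards [eventually_eLpNorm_dist_translate_le hp hf hl 0 (l + 1) hε3] with s hs x
  obtain ⟨τ, hτ, hτx⟩ := hshift x
  have hm := fun τ => stronglyMeasurable_dist_translate hf τ
  have hm' := fun τ σ => ((hm τ).comp_measurable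
    (measurable_add_const σ)).aestronglyMeasurable (μ := volume)
  have h1 : windowNorm p (fun t => dist (f (t + s + τ)) (f (t + s))) x ≤ ε / 3 := by
    rw [windowNorm_comp_add (g := fun t => dist (f (t + τ)) (f t)) (hm τ).aestronglyMeasurable]
    exact hτ _
  have h2 : windowNorm p (fun t => dist (f (t + τ + s)) (f (t + τ))) x ≤ ε / 3 := by
    rw [windowNorm_comp_add (g := fun t => dist (f (t + s)) (f t)) (hm s).aestronglyMeasurable]
    exact (windowNorm_le_eLpNorm hτx.1 (by linarith [hτx.2])).trans hs
  refine le_trans (windowNorm_mono (fun t => ?_) x)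
    ((windowNorm_add_le hp ((hm' τ s).add (hm' s τ)) (hm τ).aestronglyMeasurable x).trans
    ((add_le_add ((windowNorm_add_le hp (hm' τ s) (hm' s τ) x).trans (add_le_add h1 h2))
      (hτ x)).trans (ENNReal.add_thirds ε).le))
  have h3 := dist_triangle4 (f (t + s)) (f (t + s + τ)) (f (t + τ)) (f t)
  rw [dist_comm (f (t + s)) (f (t + s + τ)), show t + s + τ = t + τ + s by ring] at h3
  simpa [abs_dist, show t + s + τ = t + τ + s by ring] using h3

theorem SpAP.finCol (hp : 1 ≤ p) (hf : StronglyMeasurable f) (hl : LocInt p f)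
    (hap : SpAP p f) {ε : ℝ≥0∞} (hε : ε ≠ 0) : FinCol (StepanovPeriod p f ε) := by
  have hε3 : ε / 3 ≠ 0 := ENNReal.div_ne_zero.2 ⟨hε, by simp⟩
  obtain ⟨δ, hδ, hball⟩ := Metric.eventually_nhds_iff.1
    (hap.eventually_stepanovPeriod hp hf hl hε3)
  obtain ⟨l, hl0, hshift⟩ := hap.exists_shift hp hf hl hε3
  refine FinCol.of_bounded_remainder (S := StepanovPeriod p f (ε / 3)) (l := l) hδ (fun τ => ?_)
    (fun τ σ s hτ hσ hs => ?_)
  · obtain ⟨σ, hσ, hστ⟩ := hshift τ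
    exact ⟨τ + σ, hστ, by simpa using hσ.neg hf⟩
  · rw [sub_eq_add_neg, ← ENNReal.add_thirds ε]
    exact (hτ.add hp hf (hσ.neg hf)).add hp hf (hball (by simpa using hs))

end Stepanov

theorem dist_superposition_le {E : Type*} [PseudoMetricSpace E] {f : ℝ → E → E} {L : ℝ → ℝ}
    (hlip : ∀ (t : ℝ) (x y : E), dist (f t x) (f t y) ≤ L t * dist x y)
    (u : ℝ → E) (K : Finset E) (hK : K.Nonempty) (τ t : ℝ) :
    dist (f (t + τ) (u (t + τ))) (f t (u t)) ≤
      L (t + τ) * dist (u (t + τ)) (u t) + (L (t + τ) * Metric.infDist (u t) K +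
        L t * Metric.infDist (u t) K) + ∑ z ∈ K, dist (f (t + τ) z) (f t z) := by
  obtain ⟨z, hz, hzt⟩ := exists_mem_infDist_eq K hK (u t)
  have h1 := Finset.single_le_sum (f := fun z => dist (f (t + τ) z) (f t z))
    (fun _ _ => dist_nonneg) hz
  have h2 := hlip (t + τ) (u (t + τ)) (u t)
  have h3 := hlip (t + τ) (u t) z
  have h4 := hlip t z (u t)
  have h5 := dist_triangle (f (t + τ) (u (t + τ))) (f (t + τ) (u t)) (f t (u t))
  have h6 := dist_triangle4 (f (t + τ) (u t)) (f (t + τ) z) (f t z) (f t (u t))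
  rw [dist_comm z] at h4
  rw [hzt]
  linarith

/-- superposition theorem: if `f(·,x)` is `S^p`-almost periodic for every `x`,
`f` is Lipschitz in the second variable with an `S^r`-bounded Lipschitz function `L`, and
`1/p = 1/q + 1/r`, then for every `S^q`-almost periodic `u : ℝ → E`, the Nemytskii function
`t ↦ f(t, u(t))` is `S^p`-almost periodic. -/
theorem stmt5 {E : Type*} [MetricSpace E] [CompleteSpace E]
    [MeasurableSpace E] [OpensMeasurableSpace E]
    (p q r : ℝ) (hp : 1 ≤ p) (hq : 1 ≤ q) (hr : 1 ≤ r) (hpqr : 1 / p = 1 / q + 1 / r)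
    (f : ℝ → E → E)
    (hfm : ∀ x, Measurable fun t => f t x)
    (hfl : ∀ x, LocInt p fun t => f t x)
    (hfap : ∀ x : E, SpAP p fun t => f t x)
    (L : ℝ → ℝ) (hL0 : ∀ t, 0 ≤ L t) (hLm : Measurable L)
    (hLint : ∀ a b : ℝ, IntervalIntegrable (fun t => L t ^ r) volume a b)
    (hLbdd : BddAbove (Set.range fun x : ℝ => (∫ t in x..(x + 1), L t ^ r) ^ (1 / r)))
    (hlip : ∀ (t : ℝ) (x y : E), dist (f t x) (f t y) ≤ L t * dist x y)
    (u : ℝ → E) (hum : Measurable u) (hul : LocInt q u) (huap : SpAP q u) :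
    SpAP p (fun t => f t (u t)) := by
  have hu := stronglyMeasurable_of_standardBorel hum
  have hf := fun z => stronglyMeasurable_of_standardBorel (hfm z)
  obtain ⟨C, hC⟩ := hLbdd
  have hLC : ∀ x, windowNorm r L x ≤ ENNReal.ofReal C := fun x => by
    rw [windowNorm_eq_of_memLp hr hL0 (memLp_of_intervalIntegrable hr hL0 (by linarith) (hLint _ _))]
    exact ENNReal.ofReal_le_ofReal (hC ⟨x, rfl⟩)
  refine spAP_of_relDense_stepanovPeriod hp fun ε hε => ?_
  have hε2 : ENNReal.ofReal ε / 2 ≠ 0 := by simpa using hε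
  obtain ⟨η, hη, hηC⟩ := ENNReal.exists_nnreal_pos_mul_lt
    (a := ENNReal.ofReal C + (ENNReal.ofReal C + ENNReal.ofReal C)) (by simp) hε2
  have hη0 : (η : ℝ≥0∞) ≠ 0 := by simpa using hη.ne'
  obtain ⟨K, hK, hKu⟩ := huap.exists_finset_windowNorm_infDist_le hq hu hul hη0
  have hcol := (huap.finCol hq hu hul hη0).and (FinCol.forall_mem K.finite_toSet fun z _ =>
    (hfap z).finCol hp (hf z) (hfl z) (ε := ENNReal.ofReal ε / 2 / K.card)
      (ENNReal.div_ne_zero.2 ⟨hε2, ENNReal.natCast_ne_top _⟩))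
  obtain ⟨l, hl0, hl⟩ := hcol.relDense
  refine ⟨l, hl0, fun a => ?_⟩
  obtain ⟨τ, ⟨hτu, hτf⟩, hτa⟩ := hl a
  refine ⟨τ, fun x => ?_, hτa⟩
  have hLτ : ∀ x, windowNorm r (fun t => L (t + τ)) x ≤ ENNReal.ofReal C := fun x => by
    rw [windowNorm_comp_add hLm.aestronglyMeasurable]
    exact hLC _
  have mL : AEStronglyMeasurable L volume := hLm.aestronglyMeasurable
  have mLτ : AEStronglyMeasurable (fun t => L (t + τ)) volume :=
    (hLm.comp (measurable_add_const τ)).aestronglyMeasurable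
  have mu := (stronglyMeasurable_dist_translate hu τ).aestronglyMeasurable (μ := volume)
  have mK := aestronglyMeasurable_infDist hu K volume
  have mf := fun z => (stronglyMeasurable_dist_translate (hf z) τ).aestronglyMeasurable
    (μ := volume)
  have hmul := fun {g h : ℝ → ℝ} (hg : AEStronglyMeasurable g volume)
    (hh : AEStronglyMeasurable h volume) => windowNorm_mul_le hp hq hr hpqr hg hh x
  calc windowNorm p (fun t => dist (f (t + τ) (u (t + τ))) (f t (u t))) x
      ≤ windowNorm p (fun t => L (t + τ) * dist (u (t + τ)) (u t) +
          (L (t + τ) * Metric.infDist (u t) K + L t * Metric.infDist (u t) K) +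
            ∑ z ∈ K, dist (f (t + τ) z) (f t z)) x := by
        refine windowNorm_mono (fun t => ?_) x
        rw [abs_dist]
        exact dist_superposition_le hlip u K hK τ t
    _ ≤ (ENNReal.ofReal C * η + (ENNReal.ofReal C * η + ENNReal.ofReal C * η)) +
          ∑ z ∈ K, ENNReal.ofReal ε / 2 / K.card := by
        refine (windowNorm_add_le hp ((mLτ.mul mu).add ((mLτ.mul mK).add (mL.mul mK)))
          (Finset.aestronglyMeasurable_fun_sum _ fun z _ => mf z) x).trans (add_le_add ?_ ?_)
        · refine (windowNorm_add_le hp (mLτ.mul mu) ((mLτ.mul mK).add (mL.mul mK)) x).trans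
            (add_le_add ?_ ((windowNorm_add_le hp (mLτ.mul mK) (mL.mul mK) x).trans
              (add_le_add ?_ ?_)))
          · exact (hmul mLτ mu).trans (mul_le_mul' (hLτ x) (hτu x))
          · exact (hmul mLτ mK).trans (mul_le_mul' (hLτ x) (hKu x))
          · exact (hmul mL mK).trans (mul_le_mul' (hLC x) (hKu x))
        · exact (windowNorm_sum_le hp K (fun z _ => mf z) x).trans
            (Finset.sum_le_sum fun z hz => hτf z hz x)
    _ ≤ ENNReal.ofReal ε / 2 + ENNReal.ofReal ε / 2 := by
        refine add_le_add (le_of_eq_of_le ?_ hηC.le) (sum_div_card_le K _)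
        ring
    _ = ENNReal.ofReal ε := ENNReal.add_halves _
end

section
/- Let μ be a positive Borel measure on ℝ with μ(ℝ) = ∞ and μ(I) < ∞ for every bounded interval I, satisfying condition (H). Let (E,d) be a complete metric space and p, q, r ≥ 1 with 1/p = 1/q + 1/r. Let F, G : ℝ × E → E be such that: G is S^p-almost periodic uniformly on compact subsets of E; the function H(t,x) = d(F(t,x), G(t,x)) is Stepanov μ-ergodic of order p uniformly on compact subsets of E; and both F and G satisfy the Lipschitz condition d(F(t,u),F(t,v)) ≤ L(t)·d(u,v) and d(G(t,u),G(t,v)) ≤ L(t)·d(u,v) for all t ∈ ℝ, u, v ∈ E, for a nonnegative S^r-bounded function L. If X : ℝ → E is Stepanov μ-pseudo almost periodic of order q, then t ↦ F(t, X(t)) is Stepanov μ-pseudo almost periodic of order p. -/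
open MeasureTheory Filter Topology

/-- Condition (H) on the measure `μ`. -/
def CondH (μ : Measure ℝ) : Prop :=
  ∀ τ : ℝ, ∃ β > (0:ℝ), ∃ a b : ℝ, ∀ A : Set ℝ, MeasurableSet A → A ∩ Set.Icc a b = ∅ →
    μ ((fun t => t + τ) '' A) ≤ ENNReal.ofReal β * μ A

/-- A parametric function `G` is `S^p`-almost periodic uniformly on compact subsets of `E`. -/
def SpAPUc {E : Type*} [PseudoMetricSpace E] (p : ℝ) (G : ℝ → E → E) : Prop :=
  ∀ K : Set E, IsCompact K → ∀ ε > 0, RelDense {τ : ℝ | ∀ x ∈ K, ∀ u : ℝ,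
    (∫ t in u..(u + 1), dist (G (t + τ) x) (G t x) ^ p) ^ (1 / p) ≤ ε}

/-- `f : ℝ → E` is Stepanov `μ`-pseudo almost periodic of order `p`: it is measurable,
locally `p`-integrable, and there is an `S^p`-almost periodic `g` such that the Stepanov
distance `t ↦ (∫_0^1 d(f(t+s), g(t+s))^p ds)^{1/p}` is `μ`-ergodic. -/
def SpPAP {E : Type*} [PseudoMetricSpace E] [MeasurableSpace E]
    (μ : Measure ℝ) (p : ℝ) (f : ℝ → E) : Prop :=
  Measurable f ∧ LocInt p f ∧ ∃ g : ℝ → E, Measurable g ∧ LocInt p g ∧ SpAP p g ∧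
    Tendsto (fun r : ℝ => (1 / (μ (Set.Icc (-r) r)).toReal) *
        ∫ t in Set.Icc (-r) r,
          (∫ s in (0:ℝ)..1, dist (f (t + s)) (g (t + s)) ^ p) ^ (1 / p) ∂μ)
      atTop (𝓝 0)

section SeparableRange

/-- A map with closed fibres, all of whose preimages are Borel, has a Borel transversal. -/
theorem exists_measurable_transversal {α β : Type*} [MetricSpace α] [CompleteSpace α]
    [SecondCountableTopology α] [MeasurableSpace α] [BorelSpace α] (f : α → β)
    (hf : ∀ S : Set β, MeasurableSet (f ⁻¹' S)) (hc : ∀ b, IsClosed (f ⁻¹' {b})) :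
    ∃ T : Set α, MeasurableSet T ∧ Set.InjOn f T ∧ f '' T = Set.range f := by
  classical
  rcases isEmpty_or_nonempty α with hα | hα
  · exact ⟨∅, MeasurableSet.empty, by simp, by simp [Set.range_eq_empty]⟩
  obtain ⟨x, hx⟩ := TopologicalSpace.exists_dense_seq α
  let B : ℕ → ℕ → Set α := fun n k => Metric.closedBall (x k) ((1 / 2 : ℝ) ^ n)
  have hBcov : ∀ n a, ∃ k, a ∈ B n k := by
    intro n a
    obtain ⟨k, hk⟩ := hx.exists_dist_lt a (show (0:ℝ) < (1 / 2) ^ n by positivity)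
    exact ⟨k, Metric.mem_closedBall.2 hk.le⟩
  let step : ℕ → Set α → Set α := fun n A =>
    {a | a ∈ A ∧ ∃ k, a ∈ B n k ∧ ∀ i < k, f a ∉ f '' (A ∩ B n i)}
  let A : ℕ → Set α := fun n => Nat.rec Set.univ step n
  have hA0 : A 0 = Set.univ := rfl
  have hAs : ∀ n, A (n + 1) = step n (A n) := fun n => rfl
  have hstep : ∀ n S, step n S =
      ⋃ k, ((S ∩ B n k) ∩ ⋂ i, ⋂ (_ : i < k), f ⁻¹' (f '' (S ∩ B n i))ᶜ) := by
    intro n S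
    ext a
    simp only [step, Set.mem_ofPred_eq, Set.mem_iUnion, Set.mem_inter_iff, Set.mem_iInter,
      Set.mem_preimage, Set.mem_compl_iff]
    constructor
    · rintro ⟨h1, k, h2, h3⟩
      exact ⟨k, ⟨h1, h2⟩, h3⟩
    · rintro ⟨k, ⟨h1, h2⟩, h3⟩
      exact ⟨h1, k, h2, h3⟩
  have hAm : ∀ n, MeasurableSet (A n) := by
    intro n
    induction n with
    | zero => exact MeasurableSet.univ
    | succ n ih =>
      rw [hAs, hstep]
      refine MeasurableSet.iUnion fun k => (ih.inter Metric.isClosed_closedBall.measurableSet).inter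
        (MeasurableSet.iInter fun i => MeasurableSet.iInter fun _ => hf _)
  have hkey : ∀ n b, (A n ∩ f ⁻¹' {b}).Nonempty →
      ∃ k, A (n + 1) ∩ f ⁻¹' {b} = (A n ∩ f ⁻¹' {b}) ∩ B n k ∧
        (A (n + 1) ∩ f ⁻¹' {b}).Nonempty := by
    rintro n b ⟨a, ha, hab⟩
    have hex : ∃ k, b ∈ f '' (A n ∩ B n k) := by
      obtain ⟨k, hk⟩ := hBcov n a
      exact ⟨k, a, ⟨ha, hk⟩, hab⟩
    have heq : A (n + 1) ∩ f ⁻¹' {b} = (A n ∩ f ⁻¹' {b}) ∩ B n (Nat.find hex) := by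
      rw [hAs]
      ext c
      constructor
      · rintro ⟨⟨h1, k, h2, h3⟩, h4⟩
        have h4' : f c = b := h4
        refine ⟨⟨h1, h4⟩, ?_⟩
        have : Nat.find hex = k := by
          rw [Nat.find_eq_iff]
          refine ⟨⟨c, ⟨h1, h2⟩, h4'⟩, fun i hi => ?_⟩
          rw [← h4']
          exact h3 i hi
        rw [this]
        exact h2
      · rintro ⟨⟨h1, h4⟩, h2⟩
        have h4' : f c = b := h4
        refine ⟨⟨h1, Nat.find hex, h2, fun i hi => ?_⟩, h4⟩
        rw [h4']
        exact Nat.find_min hex hi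
    refine ⟨Nat.find hex, heq, ?_⟩
    rw [heq]
    obtain ⟨c, ⟨hc1, hc2⟩, hc3⟩ := Nat.find_spec hex
    exact ⟨c, ⟨hc1, hc3⟩, hc2⟩
  have hanti : Antitone A := antitone_nat_of_succ_le fun n a ha => by
    rw [hAs] at ha
    exact ha.1
  have hhalf : Tendsto (fun n : ℕ => 2 * (1 / 2 : ℝ) ^ n) atTop (𝓝 0) := by
    simpa using (tendsto_pow_atTop_nhds_zero_of_lt_one (by norm_num : (0:ℝ) ≤ 1 / 2)
      (by norm_num)).const_mul 2
  refine ⟨⋂ n, A n, MeasurableSet.iInter hAm, ?_, ?_⟩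
  · intro a ha a' ha' haa
    rw [Set.mem_iInter] at ha ha'
    have hle : ∀ n, dist a a' ≤ 2 * (1 / 2 : ℝ) ^ n := by
      intro n
      obtain ⟨k, hk, -⟩ := hkey n (f a) ⟨a, ha n, rfl⟩
      have h1 : a ∈ B n k := (hk.subset ⟨ha (n + 1), rfl⟩).2
      have h2 : a' ∈ B n k := (hk.subset ⟨ha' (n + 1), haa.symm⟩).2
      have := dist_triangle_right a a' (x k)
      rw [Metric.mem_closedBall] at h1 h2
      linarith
    exact dist_le_zero.1 (ge_of_tendsto' hhalf hle)
  · apply Set.Subset.antisymm (Set.image_subset_range _ _)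
    rintro _ ⟨a, rfl⟩
    have hne : ∀ n, (A n ∩ f ⁻¹' {f a}).Nonempty := by
      intro n
      induction n with
      | zero => exact ⟨a, trivial, rfl⟩
      | succ n ih => exact (hkey n _ ih).choose_spec.2
    have hcl : ∀ n, IsClosed (A n ∩ f ⁻¹' {f a}) := by
      intro n
      induction n with
      | zero => simpa [hA0] using hc (f a)
      | succ n ih =>
        obtain ⟨k, hk, -⟩ := hkey n _ (hne n)
        rw [hk]
        exact ih.inter Metric.isClosed_closedBall
    have hsub : ∀ n, ∃ k, A (n + 1) ∩ f ⁻¹' {f a} ⊆ B n k := by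
      intro n
      obtain ⟨k, hk, -⟩ := hkey n _ (hne n)
      exact ⟨k, hk ▸ Set.inter_subset_right⟩
    have hT : (⋂ n, A (n + 1) ∩ f ⁻¹' {f a}).Nonempty := by
      refine Metric.nonempty_iInter_of_nonempty_biInter (fun n => hcl (n + 1)) (fun n => ?_)
        (fun N => ?_) ?_
      · obtain ⟨k, hk⟩ := hsub n
        exact Metric.isBounded_closedBall.subset hk
      · obtain ⟨c, hc1, hc2⟩ := hne (N + 1)
        refine ⟨c, Set.mem_iInter₂.2 fun n hn => ⟨hanti (Nat.succ_le_succ hn) hc1, hc2⟩⟩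
      · refine squeeze_zero (fun n => Metric.diam_nonneg) (fun n => ?_) hhalf
        obtain ⟨k, hk⟩ := hsub n
        exact (Metric.diam_mono hk Metric.isBounded_closedBall).trans
          (Metric.diam_closedBall (by positivity))
    obtain ⟨c, hcT⟩ := hT
    rw [Set.mem_iInter] at hcT
    refine ⟨c, Set.mem_iInter.2 fun n => hanti (Nat.le_succ n) (hcT n).1, (hcT 0).2⟩

/-- A standard Borel space in which every set is measurable is countable. -/
theorem countable_of_discrete_standardBorel (α : Type*) [MeasurableSpace α] [StandardBorelSpace α]
    (h : ∀ s : Set α, MeasurableSet s) : Countable α := by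
  by_contra hα
  let e : α ≃ᵐ ℝ := PolishSpace.measurableEquivOfNotCountable hα not_countable
  have hR : ∀ s : Set ℝ, MeasurableSet s := fun s => by
    rw [← e.measurableSet_preimage]
    exact h _
  have h1 : Cardinal.mk {t : Set ℝ | MeasurableSet t} ≤ Cardinal.continuum := by
    have hb : Real.measurableSpace = MeasurableSpace.generateFrom
        (⋃ (a : ℚ) (b : ℚ) (_ : a < b), {Set.Ioo (a : ℝ) b}) := by
      rw [← Real.borel_eq_generateFrom_Ioo_rat]
      exact BorelSpace.measurable_eq
    rw [hb]
    refine MeasurableSpace.cardinal_measurableSet_le_continuum ?_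
    refine le_trans ?_ Cardinal.aleph0_le_continuum
    refine Set.Countable.le_aleph0 ?_
    refine Set.countable_iUnion fun a => Set.countable_iUnion fun b =>
      Set.countable_iUnion fun _ => Set.countable_singleton _
  have h2 : {t : Set ℝ | MeasurableSet t} = Set.univ := Set.eq_univ_of_forall hR
  rw [h2, Cardinal.mk_univ, Cardinal.mk_set, Cardinal.mk_real] at h1
  exact absurd h1 (not_le.2 (Cardinal.cantor _))

/-- A map from a standard Borel space all of whose preimages are measurable has countable range. -/
theorem countable_range_of_measurableSet_preimage {α β : Type*} [MeasurableSpace α]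
    [StandardBorelSpace α] (j : β → ℝ) (hj : Function.Injective j) (f : α → β)
    (hf : ∀ S : Set β, MeasurableSet (f ⁻¹' S)) : (Set.range f).Countable := by
  let _ := upgradeStandardBorel α
  have hpol₀ : PolishSpace α := inferInstance
  have hjf : Measurable (j ∘ f) := fun s _ => hf (j ⁻¹' s)
  obtain ⟨t', ht', hcont, hpol⟩ := hjf.exists_continuous
  have hb : @BorelSpace α t' _ := by
    constructor
    rw [borel_eq_borel_of_le hpol hpol₀ ht']
    exact BorelSpace.measurable_eq
  let _ : TopologicalSpace α := t'
  let _ := TopologicalSpace.upgradeIsCompletelyMetrizable α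
  obtain ⟨T, hT, hinj, hran⟩ := exists_measurable_transversal f hf fun b => by
    have : f ⁻¹' {b} = (j ∘ f) ⁻¹' {j b} := by
      ext a
      simp [hj.eq_iff]
    rw [this]
    exact isClosed_singleton.preimage hcont
  rw [← hran]
  refine Set.Countable.image ?_ f
  have := hT.standardBorel
  refine Set.countable_coe_iff.1 (countable_of_discrete_standardBorel T fun s => ?_)
  have : s = Subtype.val ⁻¹' (f ⁻¹' (f '' (Subtype.val '' s))) := by
    ext a
    constructor
    · intro ha
      exact ⟨a, ⟨a, ha, rfl⟩, rfl⟩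
    · rintro ⟨_, ⟨c, hc, rfl⟩, hca⟩
      have := hinj c.2 a.2 hca
      rwa [← Subtype.ext this]
  rw [this]
  exact measurable_subtype_coe (hf _)

/-- A Borel measurable map from the line to a metric space has separable range. -/
theorem secondCountableTopology_range_of_measurable {E : Type*} [MetricSpace E] [MeasurableSpace E]
    [BorelSpace E] {f : ℝ → E} (hf : Measurable f) :
    SecondCountableTopology (Set.range f) := by
  refine Metric.secondCountable_of_almost_dense_set fun ε hε => ?_
  obtain ⟨D, -, hD⟩ : ∃ D : Set (Set.range f), ∅ ⊆ D ∧
      Maximal (fun D : Set (Set.range f) => D.Pairwise fun x y => ε < dist x y) D := by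
    refine zorn_subset_nonempty {D : Set (Set.range f) | D.Pairwise fun x y => ε < dist x y}
      (fun c hc hchain hne => ⟨⋃₀ c, ?_, fun s hs => Set.subset_sUnion_of_mem hs⟩) ∅
      (Set.pairwise_empty _)
    exact (Set.pairwise_sUnion hchain.directedOn).2 fun s hs => hc hs
  refine ⟨D, ?_, fun x => ?_⟩
  · let D' : Set E := Subtype.val '' D
    have hD' : D'.Pairwise fun x y => ε < dist x y := by
      rintro _ ⟨x, hx, rfl⟩ _ ⟨y, hy, rfl⟩ hxy
      exact hD.1 hx hy fun h => hxy (congrArg _ h)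
    have hcl : ∀ S ⊆ D', IsClosed S := by
      intro S hS
      refine Metric.isClosed_of_pairwise_le_dist hε fun x hx y hy hxy => ?_
      exact (hD' (hS hx) (hS hy) hxy).le
    have hmeas : ∀ S ⊆ D', MeasurableSet (f ⁻¹' S) := fun S hS => hf (hcl S hS).measurableSet
    have hA : MeasurableSet (f ⁻¹' D') := hmeas D' subset_rfl
    have := hA.standardBorel
    let g : f ⁻¹' D' → D' := fun a => ⟨f a, a.2⟩
    have hsec : ∀ d : D', ∃ a, f a = d := by
      rintro ⟨_, ⟨⟨_, a, rfl⟩, _, rfl⟩⟩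
      exact ⟨a, rfl⟩
    choose j hj using hsec
    have hg := countable_range_of_measurableSet_preimage j
      (fun a b hab => Subtype.ext (by rw [← hj a, ← hj b, hab])) g fun S => by
        have : g ⁻¹' S = Subtype.val ⁻¹' (f ⁻¹' (Subtype.val '' S)) := by
          ext a
          constructor
          · intro ha
            exact ⟨g a, ha, rfl⟩
          · rintro ⟨d, hd, hda⟩
            have : g a = d := Subtype.ext hda.symm
            rwa [Set.mem_preimage, this]
        rw [this]
        refine measurable_subtype_coe (hmeas _ ?_)
        rintro _ ⟨d, _, rfl⟩
        exact d.2
    have hg' : Set.range g = Set.univ := Set.eq_univ_of_forall fun d =>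
      ⟨⟨j d, by rw [Set.mem_preimage, hj]; exact d.2⟩, Subtype.ext (hj d)⟩
    rw [hg', Set.countable_univ_iff, Set.countable_coe_iff] at hg
    exact Set.countable_of_injective_of_countable_image Subtype.val_injective.injOn hg
  · by_contra! hx
    have hxD : x ∉ D := fun h => by
      have := hx x h
      rw [dist_self] at this
      exact absurd this (not_lt.2 hε.le)
    refine hxD (hD.2 (y := insert x D) ?_ (Set.subset_insert _ _) (Set.mem_insert _ _))
    refine Set.pairwise_insert.2 ⟨hD.1, fun b hb _ => ⟨hx b hb, ?_⟩⟩
    rw [dist_comm]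
    exact hx b hb

theorem stronglyMeasurable_of_measurable_real {E : Type*} [MetricSpace E] [MeasurableSpace E]
    [BorelSpace E] {f : ℝ → E} (hf : Measurable f) : StronglyMeasurable f := by
  have := secondCountableTopology_range_of_measurable hf
  refine stronglyMeasurable_iff_measurable_separable.2 ⟨hf, ?_⟩
  exact TopologicalSpace.IsSeparable.of_subtype _

theorem measurable_dist_of_real {E : Type*} [MetricSpace E] [MeasurableSpace E]
    [BorelSpace E] {f g : ℝ → E} (hf : Measurable f) (hg : Measurable g) :
    Measurable fun t => dist (f t) (g t) :=
  ((stronglyMeasurable_of_measurable_real hf).dist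
    (stronglyMeasurable_of_measurable_real hg)).measurable

end SeparableRange

open scoped ENNReal

section AlmostPeriodFamilies

/-- The abstract properties of the sets of `ε`-almost periods of a uniformly continuous
almost periodic function. -/
structure IsAlmostPeriodFamily (A : ℝ → Set ℝ) : Prop where
  relDense : ∀ ε > 0, RelDense (A ε)
  nhds_zero : ∀ ε > 0, ∃ δ > 0, ∀ h : ℝ, |h| ≤ δ → h ∈ A ε
  sub_mem : ∀ ε > 0, ∀ ε' > 0, ∀ a ∈ A ε, ∀ b ∈ A ε', a - b ∈ A (ε + ε')

/-- Two families of almost periods have relatively dense common almost periods. -/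
theorem IsAlmostPeriodFamily.relDense_inter {A B : ℝ → Set ℝ} (hA : IsAlmostPeriodFamily A)
    (hB : IsAlmostPeriodFamily B) {ε : ℝ} (hε : 0 < ε) : RelDense (A ε ∩ B ε) := by
  have h4 : 0 < ε / 4 := by positivity
  have h42 : 0 < ε / 4 + ε / 4 := by positivity
  obtain ⟨l, hl, hAl⟩ := hA.relDense _ h4
  obtain ⟨m, hm, hBm⟩ := hB.relDense _ h4
  obtain ⟨δ, hδ, hAδ⟩ := hA.nhds_zero _ h42
  obtain ⟨δ', hδ', hBδ⟩ := hB.nhds_zero _ h42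
  choose σ hσ hσI using hAl
  choose τ hτ hτI using hBm
  have htb : TotallyBounded (Set.range fun t => σ t - τ t) := by
    refine (totallyBounded_Icc (-m) l).subset ?_
    rintro _ ⟨t, rfl⟩
    have h1 := hσI t
    have h2 := hτI t
    constructor <;> simp only [Set.mem_Icc] at h1 h2 ⊢ <;> linarith [h1.1, h1.2, h2.1, h2.2]
  obtain ⟨N, hN, hNf, hcov⟩ := Metric.finite_approx_of_totallyBounded htb δ' hδ'
  have hch : ∀ y ∈ N, ∃ t, σ t - τ t = y := fun y hy => hN hy
  choose! c hc using hch
  obtain ⟨M, hM⟩ : ∃ M, ∀ y ∈ N, |σ (c y)| ≤ M := by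
    obtain ⟨M, hM⟩ := (hNf.image fun y => |σ (c y)|).bddAbove
    exact ⟨M, fun y hy => hM ⟨y, hy, rfl⟩⟩
  refine ⟨l + 2 * |M| + 1, by positivity, fun a => ?_⟩
  have hmem := hcov ⟨a + |M|, rfl⟩
  simp only [Set.mem_iUnion, Metric.mem_ball, Real.dist_eq] at hmem
  obtain ⟨y, hy, hya⟩ := hmem
  rw [← hc y hy] at hya
  refine ⟨σ (a + |M|) - σ (c y), ⟨?_, ?_⟩, ?_⟩
  · have := hA.sub_mem _ h42 _ h42 _
      (hA.sub_mem _ h4 _ h4 _ (hσ (a + |M|)) _ (hσ (c y))) 0 (hAδ 0 (by simpa using hδ.le))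
    rwa [sub_zero, show ε / 4 + ε / 4 + (ε / 4 + ε / 4) = ε by ring] at this
  · have := hB.sub_mem _ h42 _ h42 _
      (hB.sub_mem _ h4 _ h4 _ (hτ (a + |M|)) _ (hτ (c y))) _ (hBδ _ ((abs_neg _).trans_le hya.le))
    rw [show ε / 4 + ε / 4 + (ε / 4 + ε / 4) = ε by ring] at this
    convert this using 1
    ring
  · have h1 := hσI (a + |M|)
    have h2 := abs_le.1 ((hM y hy).trans (le_abs_self M))
    simp only [Set.mem_Icc] at h1 ⊢
    constructor <;> linarith [h1.1, h1.2, h2.1, h2.2]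

end AlmostPeriodFamilies

section LocalNorm

/-- The `L^P` norm over the unit interval starting at `u`. -/
noncomputable def localNorm (P : ℝ≥0∞) (φ : ℝ → ℝ) (u : ℝ) : ℝ≥0∞ :=
  eLpNorm φ P (volume.restrict (Set.Ioc u (u + 1)))

theorem localNorm_mono {P : ℝ≥0∞} {φ ψ : ℝ → ℝ} (h0 : ∀ t, 0 ≤ φ t) (h : ∀ t, φ t ≤ ψ t)
    (u : ℝ) : localNorm P φ u ≤ localNorm P ψ u := by
  refine eLpNorm_mono_real fun t => ?_
  rw [Real.norm_of_nonneg (h0 t)]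
  exact h t

theorem localNorm_add_le {P : ℝ≥0∞} (hP : 1 ≤ P) {φ ψ : ℝ → ℝ} (hφ : Measurable φ)
    (hψ : Measurable ψ) (u : ℝ) :
    localNorm P (fun t => φ t + ψ t) u ≤ localNorm P φ u + localNorm P ψ u :=
  eLpNorm_add_le hφ.aestronglyMeasurable hψ.aestronglyMeasurable hP

theorem localNorm_sum_le {ι : Type*} {P : ℝ≥0∞} (hP : 1 ≤ P) (s : Finset ι) {φ : ι → ℝ → ℝ}
    (hφ : ∀ i ∈ s, Measurable (φ i)) (u : ℝ) :
    localNorm P (fun t => ∑ i ∈ s, φ i t) u ≤ ∑ i ∈ s, localNorm P (φ i) u := by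
  have := eLpNorm_sum_le (f := φ) (s := s) (p := P) (μ := volume.restrict (Set.Ioc u (u + 1)))
    (fun i hi => (hφ i hi).aestronglyMeasurable) hP
  rwa [Finset.sum_fn] at this

theorem localNorm_mul_le {P Q R : ℝ≥0∞} [ENNReal.HolderTriple R Q P] {φ ψ : ℝ → ℝ}
    (hφ : Measurable φ) (hψ : Measurable ψ) (u : ℝ) :
    localNorm P (fun t => φ t * ψ t) u ≤ localNorm R φ u * localNorm Q ψ u :=
  eLpNorm_smul_le_mul_eLpNorm (f := ψ) (φ := φ) hψ.aestronglyMeasurable hφ.aestronglyMeasurable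

theorem eLpNorm_comp_add_restrict_Ioc {P : ℝ≥0∞} {φ : ℝ → ℝ} (hφ : Measurable φ) (τ a b : ℝ) :
    eLpNorm (fun t => φ (t + τ)) P (volume.restrict (Set.Ioc a b)) =
      eLpNorm φ P (volume.restrict (Set.Ioc (a + τ) (b + τ))) := by
  have h := (measurePreserving_add_right (volume : Measure ℝ) τ).restrict_preimage
    (measurableSet_Ioc (a := a + τ) (b := b + τ))
  rw [Set.preimage_add_const_Ioc, add_sub_cancel_right, add_sub_cancel_right] at h
  exact eLpNorm_comp_measurePreserving hφ.aestronglyMeasurable h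

theorem localNorm_comp_add {P : ℝ≥0∞} {φ : ℝ → ℝ} (hφ : Measurable φ) (τ u : ℝ) :
    localNorm P (fun t => φ (t + τ)) u = localNorm P φ (u + τ) := by
  unfold localNorm
  rw [eLpNorm_comp_add_restrict_Ioc hφ, add_right_comm]

theorem localNorm_le_eLpNorm {P : ℝ≥0∞} (φ : ℝ → ℝ) {u a b : ℝ} (ha : a ≤ u) (hb : u + 1 ≤ b) :
    localNorm P φ u ≤ eLpNorm φ P (volume.restrict (Set.Ioc a b)) :=
  eLpNorm_mono_measure _ (Measure.restrict_mono (Set.Ioc_subset_Ioc ha hb) le_rfl)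

theorem rpow_intervalIntegral_eq_localNorm {p : ℝ} (hp : 0 < p) {φ : ℝ → ℝ} (hφ : Measurable φ)
    (h0 : ∀ t, 0 ≤ φ t) (u : ℝ) :
    (∫ t in u..(u + 1), φ t ^ p) ^ (1 / p) = (localNorm (ENNReal.ofReal p) φ u).toReal := by
  rw [intervalIntegral.integral_of_le (by linarith), integral_eq_lintegral_of_nonneg_ae
    (Eventually.of_forall fun t => Real.rpow_nonneg (h0 t) p)
    (hφ.pow_const p).aestronglyMeasurable, localNorm,
    eLpNorm_eq_lintegral_rpow_enorm_toReal (by simpa using hp) ENNReal.ofReal_ne_top,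
    ENNReal.toReal_ofReal hp.le, ENNReal.toReal_rpow]
  congr 3
  ext t
  rw [Real.enorm_eq_ofReal (h0 t), ENNReal.ofReal_rpow_of_nonneg (h0 t) hp.le]

theorem intervalIntegrable_rpow_iff_memLp {p : ℝ} (hp : 0 < p) {φ : ℝ → ℝ} (hφ : Measurable φ)
    (h0 : ∀ t, 0 ≤ φ t) :
    (∀ a b, IntervalIntegrable (fun t => φ t ^ p) volume a b) ↔
      ∀ a b, MemLp φ (ENNReal.ofReal p) (volume.restrict (Set.Ioc a b)) := by
  have key : ∀ a b, IntegrableOn (fun t => φ t ^ p) (Set.Ioc a b) volume ↔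
      MemLp φ (ENNReal.ofReal p) (volume.restrict (Set.Ioc a b)) := by
    intro a b
    rw [← integrable_norm_rpow_iff hφ.aestronglyMeasurable (by simpa using hp)
      ENNReal.ofReal_ne_top, ENNReal.toReal_ofReal hp.le, IntegrableOn]
    simp only [Real.norm_of_nonneg (h0 _)]
  simp only [IntervalIntegrable, key]
  exact ⟨fun h a b => (h a b).1, fun h a b => ⟨h a b, h b a⟩⟩

/-- `t ↦ ‖φ‖_{L^p(t, t + 1)}` is continuous when `φ` is locally `p`-integrable. -/
theorem continuous_toReal_localNorm {p : ℝ} (hp : 0 < p) {φ : ℝ → ℝ} (hφ : Measurable φ)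
    (h0 : ∀ t, 0 ≤ φ t)
    (hi : ∀ a b, MemLp φ (ENNReal.ofReal p) (volume.restrict (Set.Ioc a b))) :
    Continuous fun u => (localNorm (ENNReal.ofReal p) φ u).toReal := by
  have hi' := (intervalIntegrable_rpow_iff_memLp hp hφ h0).2 hi
  have hc := intervalIntegral.continuous_primitive hi' 0
  have : (fun u => (localNorm (ENNReal.ofReal p) φ u).toReal) =
      fun u => ((∫ t in (0:ℝ)..(u + 1), φ t ^ p) - ∫ t in (0:ℝ)..u, φ t ^ p) ^ (1 / p) := by
    ext u
    rw [← rpow_intervalIntegral_eq_localNorm hp hφ h0,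
      intervalIntegral.integral_interval_sub_left (hi' _ _) (hi' _ _)]
  rw [this]
  refine Continuous.rpow_const ?_ fun _ => Or.inr (by positivity)
  exact (hc.comp (continuous_id.add continuous_const)).sub hc

end LocalNorm

section LpLocal

variable {E : Type*} [MetricSpace E] [MeasurableSpace E] [BorelSpace E]

/-- Measurable, locally `P`-integrable functions with values in a metric space. -/
structure LpLocal (P : ℝ≥0∞) (f : ℝ → E) : Prop where
  meas : Measurable f
  memLp : ∀ x₀ a b, MemLp (fun t => dist (f t) x₀) P (volume.restrict (Set.Ioc a b))

theorem lpLocal_iff {p : ℝ} (hp : 0 < p) {f : ℝ → E} :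
    LpLocal (ENNReal.ofReal p) f ↔ Measurable f ∧ LocInt p f := by
  constructor
  · rintro ⟨h1, h2⟩
    exact ⟨h1, fun x₀ => (intervalIntegrable_rpow_iff_memLp hp
      (measurable_dist_of_real h1 measurable_const) fun t => dist_nonneg).2 (h2 x₀)⟩
  · rintro ⟨h1, h2⟩
    exact ⟨h1, fun x₀ => (intervalIntegrable_rpow_iff_memLp hp
      (measurable_dist_of_real h1 measurable_const) fun t => dist_nonneg).1 (h2 x₀)⟩

theorem LpLocal.memLp_dist {P : ℝ≥0∞} {f g : ℝ → E} (hf : LpLocal P f) (hg : LpLocal P g)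
    (a b : ℝ) : MemLp (fun t => dist (f t) (g t)) P (volume.restrict (Set.Ioc a b)) := by
  refine ((hf.memLp (f 0) a b).add (hg.memLp (f 0) a b)).mono'
    (measurable_dist_of_real hf.meas hg.meas).aestronglyMeasurable
    (Eventually.of_forall fun t => ?_)
  rw [Real.norm_of_nonneg dist_nonneg]
  exact dist_triangle_right _ _ _

theorem LpLocal.comp_add {P : ℝ≥0∞} {f : ℝ → E} (hf : LpLocal P f) (τ : ℝ) :
    LpLocal P fun t => f (t + τ) := by
  refine ⟨hf.meas.comp (measurable_add_const τ), fun x₀ a b => ?_⟩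
  have hm := measurable_dist_of_real hf.meas (measurable_const (a := x₀))
  refine ⟨(hm.comp (measurable_add_const τ)).aestronglyMeasurable, ?_⟩
  rw [eLpNorm_comp_add_restrict_Ioc hm]
  exact (hf.memLp x₀ _ _).2

/-- The `L^P` norm of `f(· + h) - f` on a bounded interval tends to zero with `h`. -/
theorem LpLocal.tendsto_translate {P : ℝ≥0∞} (hP : 1 ≤ P) (hP' : P ≠ ⊤) {f : ℝ → E}
    (hf : LpLocal P f) (a b : ℝ) :
    Tendsto (fun h => eLpNorm (fun t => dist (f (t + h)) (f t)) P (volume.restrict (Set.Ioc a b)))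
      (𝓝 0) (𝓝 0) := by
  have := secondCountableTopology_range_of_measurable hf.meas
  let ι := kuratowskiEmbedding (Set.range f)
  have hι : Isometry ι := kuratowskiEmbedding.isometry _
  let φ := fun t => ι ⟨f t, t, rfl⟩
  have hφd : ∀ s t, ‖φ s - φ t‖ = dist (f s) (f t) := by
    intro s t
    rw [← dist_eq_norm, hι.dist_eq]
    rfl
  have hφm : StronglyMeasurable φ :=
    hι.continuous.comp_stronglyMeasurable
      (hf.meas.subtype_mk (h := fun t => ⟨t, rfl⟩)).stronglyMeasurable
  have hφL : ∀ a b, MemLp φ P (volume.restrict (Set.Ioc a b)) := by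
    intro a b
    have h1 : MemLp (fun t => φ t - φ 0) P (volume.restrict (Set.Ioc a b)) := by
      refine (hf.memLp (f 0) a b).mono'
        (hφm.sub stronglyMeasurable_const).aestronglyMeasurable (Eventually.of_forall fun t => ?_)
      rw [hφd]
    have h2 := h1.add (memLp_const (φ 0))
    refine h2.congr_norm hφm.aestronglyMeasurable (Eventually.of_forall fun t => ?_)
    simp
  let ψ := (Set.Ioc (a - 1) (b + 1)).indicator φ
  have hψ : MemLp ψ P volume := (memLp_indicator_iff_restrict measurableSet_Ioc).2 (hφL _ _)
  have : Fact (1 ≤ P) := ⟨hP⟩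
  have : Fact (P ≠ ⊤) := ⟨hP'⟩
  have hcont : Tendsto (fun h : ℝ => edist (DomAddAct.mk h +ᵥ hψ.toLp ψ) (hψ.toLp ψ))
      (𝓝 0) (𝓝 0) := by
    have hc : Continuous fun h : ℝ => DomAddAct.mk h +ᵥ hψ.toLp ψ := by
      have : Continuous fun h : ℝ => DomAddAct.mk h := DomAddAct.continuous_mk
      exact this.vadd continuous_const
    have := (hc.edist (continuous_const (y := hψ.toLp ψ))).tendsto 0
    simpa using this
  refine tendsto_of_tendsto_of_tendsto_of_le_of_le' tendsto_const_nhds hcont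
    (Eventually.of_forall fun _ => zero_le) ?_
  filter_upwards [Metric.closedBall_mem_nhds (0 : ℝ) one_pos] with h hh
  rw [Metric.mem_closedBall, Real.dist_eq, sub_zero, abs_le] at hh
  rw [DomAddAct.mk_vadd_toLp, Lp.edist_toLp_toLp]
  refine le_trans ?_ (eLpNorm_mono_measure _ (Measure.restrict_le_self (s := Set.Ioc a b)))
  refine eLpNorm_mono_ae ?_
  filter_upwards [ae_restrict_mem measurableSet_Ioc] with t ht
  have h1 : t ∈ Set.Ioc (a - 1) (b + 1) := ⟨by linarith [ht.1], by linarith [ht.2]⟩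
  have h2 : h + t ∈ Set.Ioc (a - 1) (b + 1) := ⟨by linarith [ht.1], by linarith [ht.2]⟩
  simp only [Pi.sub_apply, vadd_eq_add, ψ, Set.indicator_of_mem h1, Set.indicator_of_mem h2]
  rw [hφd, Real.norm_of_nonneg dist_nonneg, add_comm]

theorem measurable_infDist_of_measurable {f : ℝ → E} (hf : Measurable f) (K : Set E) :
    Measurable fun t => Metric.infDist (f t) K :=
  (Metric.continuous_infDist_pt K).measurable.comp hf

/-- On a bounded interval a locally integrable function is close to a finite set in `L^P`. -/
theorem LpLocal.exists_finset_Ioc {P : ℝ≥0∞} (hP : 1 ≤ P) (hP' : P ≠ ⊤) {f : ℝ → E}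
    (hf : LpLocal P f) (a b : ℝ) {ε : ℝ} (hε : 0 < ε) :
    ∃ K : Finset E, K.Nonempty ∧
      eLpNorm (fun t => Metric.infDist (f t) K) P (volume.restrict (Set.Ioc a b)) ≤
        ENNReal.ofReal ε := by
  classical
  have := secondCountableTopology_range_of_measurable hf.meas
  have : Nonempty (Set.range f) := ⟨⟨f 0, 0, rfl⟩⟩
  let x : ℕ → E := fun n => (TopologicalSpace.denseSeq (Set.range f) n : Set.range f)
  let K : ℕ → Finset E := fun n => (Finset.range (n + 1)).image x
  have hKmem : ∀ {n k : ℕ}, k ≤ n → x k ∈ (K n : Set E) := fun {n k} hk => by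
    simp only [K, Finset.coe_image]
    exact ⟨k, by simpa using Nat.lt_succ_of_le hk, rfl⟩
  have hle : ∀ n k t, k ≤ n → Metric.infDist (f t) (K n) ≤ dist (f t) (x k) := fun n k t hk =>
    Metric.infDist_le_dist_of_mem (hKmem hk)
  have hpt : ∀ t, Tendsto (fun n => Metric.infDist (f t) (K n)) atTop (𝓝 0) := by
    intro t
    rw [Metric.tendsto_atTop]
    intro δ hδ
    obtain ⟨k, hk⟩ := (TopologicalSpace.denseRange_denseSeq (Set.range f)).exists_dist_lt
      ⟨f t, t, rfl⟩ hδ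
    refine ⟨k, fun n hn => ?_⟩
    rw [Real.dist_eq, sub_zero, abs_of_nonneg Metric.infDist_nonneg]
    exact (hle n k t hn).trans_lt hk
  have hP0 : P ≠ 0 := (zero_lt_one.trans_le hP).ne'
  have hPr : 0 < P.toReal := ENNReal.toReal_pos hP0 hP'
  have hlim : Tendsto (fun n => eLpNorm (fun t => Metric.infDist (f t) (K n)) P
      (volume.restrict (Set.Ioc a b))) atTop (𝓝 0) := by
    simp only [eLpNorm_eq_lintegral_rpow_enorm_toReal hP0 hP']
    have h1 : Tendsto (fun n => ∫⁻ t in Set.Ioc a b, ‖Metric.infDist (f t) (K n)‖ₑ ^ P.toReal)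
        atTop (𝓝 (∫⁻ _ in Set.Ioc a b, 0)) := by
      refine tendsto_lintegral_of_dominated_convergence
        (fun t => ‖dist (f t) (x 0)‖ₑ ^ P.toReal) (fun n => ?_) (fun n => ?_) ?_ ?_
      · exact (measurable_infDist_of_measurable hf.meas _).enorm.pow_const _
      · refine Eventually.of_forall fun t => ?_
        refine ENNReal.rpow_le_rpow ?_ hPr.le
        rw [Real.enorm_of_nonneg Metric.infDist_nonneg, Real.enorm_of_nonneg dist_nonneg]
        exact ENNReal.ofReal_le_ofReal (hle n 0 t (Nat.zero_le _))
      · exact (lintegral_rpow_enorm_lt_top_of_eLpNorm_lt_top hP0 hP' (hf.memLp (x 0) a b).2).ne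
      · refine Eventually.of_forall fun t => ?_
        have h2 := ((continuous_enorm.tendsto (0 : ℝ)).comp (hpt t))
        have h3 := (ENNReal.continuous_rpow_const (y := P.toReal)).tendsto _ |>.comp h2
        simpa [Function.comp_def, hPr] using h3
    have h4 := (ENNReal.continuous_rpow_const (y := 1 / P.toReal)).tendsto _ |>.comp h1
    simpa [Function.comp_def, hPr] using h4
  obtain ⟨n, hn⟩ := (hlim.eventually (gt_mem_nhds (ENNReal.ofReal_pos.2 hε))).exists
  exact ⟨K n, ⟨x 0, Finset.mem_coe.1 (hKmem (Nat.zero_le n))⟩, hn.le⟩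

/-- The set of Stepanov `ε`-almost periods of order `P`. -/
def almostPeriods (P : ℝ≥0∞) (f : ℝ → E) (ε : ℝ) : Set ℝ :=
  {τ | ∀ u, localNorm P (fun t => dist (f (t + τ)) (f t)) u ≤ ENNReal.ofReal ε}

theorem LpLocal.mem_almostPeriods_iff {p : ℝ} (hp : 0 < p) {f : ℝ → E}
    (hf : LpLocal (ENNReal.ofReal p) f) {ε τ : ℝ} (hε : 0 ≤ ε) :
    τ ∈ almostPeriods (ENNReal.ofReal p) f ε ↔
      ∀ u : ℝ, (∫ t in u..(u + 1), dist (f (t + τ)) (f t) ^ p) ^ (1 / p) ≤ ε := by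
  refine forall_congr' fun u => ?_
  rw [rpow_intervalIntegral_eq_localNorm hp
    (measurable_dist_of_real (hf.comp_add τ).meas hf.meas) fun t => dist_nonneg]
  exact ENNReal.le_ofReal_iff_toReal_le ((hf.comp_add τ).memLp_dist hf _ _).2.ne hε

theorem LpLocal.sub_mem_almostPeriods {P : ℝ≥0∞} (hP : 1 ≤ P) {f : ℝ → E} (hf : LpLocal P f)
    {ε ε' : ℝ} (hε : 0 ≤ ε) (hε' : 0 ≤ ε') {a b : ℝ} (ha : a ∈ almostPeriods P f ε)
    (hb : b ∈ almostPeriods P f ε') : a - b ∈ almostPeriods P f (ε + ε') := by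
  intro u
  have hd : ∀ c, Measurable fun t => dist (f (t + c)) (f t) := fun c =>
    measurable_dist_of_real (hf.comp_add c).meas hf.meas
  calc localNorm P (fun t => dist (f (t + (a - b))) (f t)) u
      ≤ localNorm P (fun t => dist (f (t + -b + a)) (f (t + -b)) +
          dist (f (t + -b + b)) (f (t + -b))) u := by
        refine localNorm_mono (fun _ => dist_nonneg) (fun t => ?_) u
        rw [show t + -b + b = t by ring, show t + -b + a = t + (a - b) by ring]
        exact dist_triangle_right _ _ _
    _ ≤ localNorm P (fun t => dist (f (t + -b + a)) (f (t + -b))) u +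
          localNorm P (fun t => dist (f (t + -b + b)) (f (t + -b))) u :=
        localNorm_add_le hP ((hd a).comp (measurable_add_const (-b)))
          ((hd b).comp (measurable_add_const (-b))) u
    _ ≤ ENNReal.ofReal ε + ENNReal.ofReal ε' := by
        rw [localNorm_comp_add (φ := fun t => dist (f (t + a)) (f t)) (hd a),
          localNorm_comp_add (φ := fun t => dist (f (t + b)) (f t)) (hd b)]
        exact add_le_add (ha _) (hb _)
    _ = ENNReal.ofReal (ε + ε') := (ENNReal.ofReal_add hε hε').symm

/-- A Stepanov almost periodic function is uniformly close to a finite set. -/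
theorem LpLocal.exists_finset {P : ℝ≥0∞} (hP : 1 ≤ P) (hP' : P ≠ ⊤) {f : ℝ → E}
    (hf : LpLocal P f) (hap : ∀ ε > 0, RelDense (almostPeriods P f ε)) {ε : ℝ} (hε : 0 < ε) :
    ∃ K : Finset E, K.Nonempty ∧
      ∀ u, localNorm P (fun t => Metric.infDist (f t) K) u ≤ ENNReal.ofReal ε := by
  obtain ⟨l, hl, hd⟩ := hap _ (half_pos hε)
  obtain ⟨K, hK, hKl⟩ := hf.exists_finset_Ioc hP hP' 0 (l + 1) (half_pos hε)
  refine ⟨K, hK, fun u => ?_⟩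
  obtain ⟨τ, hτ, hτ1, hτ2⟩ := hd (-u)
  have hm := measurable_infDist_of_measurable hf.meas (K : Set E)
  calc localNorm P (fun t => Metric.infDist (f t) K) u
      ≤ localNorm P (fun t => dist (f (t + τ)) (f t) + Metric.infDist (f (t + τ)) K) u := by
        refine localNorm_mono (fun _ => Metric.infDist_nonneg) (fun t => ?_) u
        rw [dist_comm, add_comm]
        exact Metric.infDist_le_infDist_add_dist
    _ ≤ localNorm P (fun t => dist (f (t + τ)) (f t)) u +
          localNorm P (fun t => Metric.infDist (f (t + τ)) K) u :=
        localNorm_add_le hP (measurable_dist_of_real (hf.comp_add τ).meas hf.meas)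
          (hm.comp (measurable_add_const τ)) u
    _ ≤ ENNReal.ofReal (ε / 2) + ENNReal.ofReal (ε / 2) := by
        refine add_le_add (hτ u) ?_
        rw [localNorm_comp_add hm]
        exact (localNorm_le_eLpNorm _ (by linarith) (by linarith)).trans hKl
    _ = ENNReal.ofReal ε := by
        rw [← ENNReal.ofReal_add (by positivity) (by positivity), add_halves]

/-- A Stepanov almost periodic function is uniformly continuous in the Stepanov distance. -/
theorem LpLocal.exists_almostPeriods_nhds {P : ℝ≥0∞} (hP : 1 ≤ P) (hP' : P ≠ ⊤) {f : ℝ → E}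
    (hf : LpLocal P f) (hap : ∀ ε > 0, RelDense (almostPeriods P f ε)) {ε : ℝ} (hε : 0 < ε) :
    ∃ δ > 0, ∀ h : ℝ, |h| ≤ δ → h ∈ almostPeriods P f ε := by
  have hε3 : 0 < ε / 3 := by positivity
  obtain ⟨l, hl, hd⟩ := hap _ hε3
  have ht := (hf.tendsto_translate hP hP' 0 (l + 1)).eventually
    (ge_mem_nhds (ENNReal.ofReal_pos.2 hε3))
  obtain ⟨δ, hδ, hball⟩ := Metric.nhds_basis_closedBall.eventually_iff.1 ht
  refine ⟨δ, hδ, fun h hh u => ?_⟩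
  have hloc := hball (x := h) (by simpa using hh)
  obtain ⟨τ, hτ, hτ1, hτ2⟩ := hd (-u)
  have hm : ∀ c, Measurable fun t => dist (f (t + c)) (f t) := fun c =>
    measurable_dist_of_real (hf.comp_add c).meas hf.meas
  calc localNorm P (fun t => dist (f (t + h)) (f t)) u
      ≤ localNorm P (fun t => (dist (f (t + h + τ)) (f (t + h)) +
          dist (f (t + τ + h)) (f (t + τ))) + dist (f (t + τ)) (f t)) u := by
        refine localNorm_mono (fun _ => dist_nonneg) (fun t => ?_) u
        rw [dist_comm (f (t + h + τ)), add_right_comm t τ h]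
        exact dist_triangle4 _ _ _ _
    _ ≤ (localNorm P (fun t => dist (f (t + h + τ)) (f (t + h))) u +
          localNorm P (fun t => dist (f (t + τ + h)) (f (t + τ))) u) +
            localNorm P (fun t => dist (f (t + τ)) (f t)) u :=
        (localNorm_add_le hP (((hm τ).comp (measurable_add_const h)).add
          ((hm h).comp (measurable_add_const τ))) (hm τ) u).trans
          (add_le_add_left (localNorm_add_le hP ((hm τ).comp (measurable_add_const h))
            ((hm h).comp (measurable_add_const τ)) u) _)
    _ ≤ (ENNReal.ofReal (ε / 3) + ENNReal.ofReal (ε / 3)) + ENNReal.ofReal (ε / 3) := by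
        refine add_le_add (add_le_add ?_ ?_) (hτ u)
        · rw [localNorm_comp_add (φ := fun t => dist (f (t + τ)) (f t)) (hm τ)]
          exact hτ _
        · rw [localNorm_comp_add (φ := fun t => dist (f (t + h)) (f t)) (hm h)]
          exact (localNorm_le_eLpNorm _ (by linarith) (by linarith)).trans hloc
    _ = ENNReal.ofReal ε := by
        rw [← ENNReal.ofReal_add hε3.le hε3.le, ← ENNReal.ofReal_add (by positivity) hε3.le]
        ring_nf

/-- Finitely many functions with relatively dense common almost periods. -/
theorem isAlmostPeriodFamily_biInter {ι : Type*} (s : Finset ι) {P : ℝ≥0∞} (hP : 1 ≤ P)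
    (hP' : P ≠ ⊤) {f : ι → ℝ → E} (hf : ∀ i ∈ s, LpLocal P (f i))
    (hap : ∀ ε > 0, RelDense {τ | ∀ i ∈ s, τ ∈ almostPeriods P (f i) ε}) :
    IsAlmostPeriodFamily fun ε => {τ | ∀ i ∈ s, τ ∈ almostPeriods P (f i) ε} := by
  refine ⟨hap, fun ε hε => ?_, fun ε hε ε' hε' a ha b hb i hi =>
    (hf i hi).sub_mem_almostPeriods hP hε.le hε'.le (ha i hi) (hb i hi)⟩
  have hap' : ∀ i ∈ s, ∀ ε > 0, RelDense (almostPeriods P (f i) ε) := by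
    intro i hi ε hε
    obtain ⟨l, hl, h⟩ := hap ε hε
    refine ⟨l, hl, fun a => ?_⟩
    obtain ⟨τ, hτ, hτa⟩ := h a
    exact ⟨τ, hτ i hi, hτa⟩
  have hev : ∀ i ∈ s, ∀ᶠ h in 𝓝 (0 : ℝ), h ∈ almostPeriods P (f i) ε := by
    intro i hi
    obtain ⟨δ, hδ, h⟩ := (hf i hi).exists_almostPeriods_nhds hP hP' (hap' i hi) hε
    filter_upwards [Metric.closedBall_mem_nhds (0 : ℝ) hδ] with x hx
    exact h x (by simpa using hx)
  have hall := (Filter.eventually_all_finset s).2 hev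
  obtain ⟨δ, hδ, hball⟩ := Metric.nhds_basis_closedBall.eventually_iff.1 hall
  exact ⟨δ, hδ, fun h hh => hball (by simpa using hh)⟩

end LpLocal

section Superposition

/-- A function on the line dominated, up to small constants, by functions with small `μ`-averages
has `μ`-averages tending to zero. -/
theorem tendsto_average_zero_of_le (μ : Measure ℝ) [IsFiniteMeasureOnCompacts μ] {N : ℝ → ℝ}
    (hN : Continuous N) (hN0 : ∀ t, 0 ≤ N t)
    (h : ∀ ε > 0, ∃ B : ℝ → ℝ, Continuous B ∧ (∀ t, N t ≤ ε + B t) ∧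
      ∀ᶠ r : ℝ in atTop,
        (1 / (μ (Set.Icc (-r) r)).toReal) * ∫ t in Set.Icc (-r) r, B t ∂μ ≤ ε) :
    Tendsto (fun r : ℝ => (1 / (μ (Set.Icc (-r) r)).toReal) * ∫ t in Set.Icc (-r) r, N t ∂μ)
      atTop (𝓝 0) := by
  have hnn : ∀ r : ℝ, 0 ≤ (1 / (μ (Set.Icc (-r) r)).toReal) * ∫ t in Set.Icc (-r) r, N t ∂μ :=
    fun r => mul_nonneg (by positivity) (integral_nonneg hN0)
  refine tendsto_order.2 ⟨fun a ha => Eventually.of_forall fun r => ha.trans_le (hnn r),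
    fun ε hε => ?_⟩
  obtain ⟨B, hB, hNB, hev⟩ := h (ε / 3) (by positivity)
  filter_upwards [hev] with r hr
  have hInt : ∀ {φ : ℝ → ℝ}, Continuous φ → IntegrableOn φ (Set.Icc (-r) r) μ := fun hφ =>
    hφ.continuousOn.integrableOn_compact isCompact_Icc
  have h1 : ∫ t in Set.Icc (-r) r, N t ∂μ ≤
      (μ (Set.Icc (-r) r)).toReal * (ε / 3) + ∫ t in Set.Icc (-r) r, B t ∂μ := by
    calc ∫ t in Set.Icc (-r) r, N t ∂μ ≤ ∫ t in Set.Icc (-r) r, (ε / 3 + B t) ∂μ :=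
          integral_mono (hInt hN) (hInt (continuous_const.add hB)) hNB
      _ = _ := by
          rw [integral_add (hInt continuous_const) (hInt hB), setIntegral_const, smul_eq_mul]
          rfl
  set m := (μ (Set.Icc (-r) r)).toReal
  have hm : 0 ≤ m := ENNReal.toReal_nonneg
  have h2 : 1 / m * m ≤ 1 := by
    rw [one_div]
    exact inv_mul_le_one
  calc 1 / m * ∫ t in Set.Icc (-r) r, N t ∂μ
      ≤ 1 / m * (m * (ε / 3) + ∫ t in Set.Icc (-r) r, B t ∂μ) := by gcongr
    _ = 1 / m * m * (ε / 3) + 1 / m * ∫ t in Set.Icc (-r) r, B t ∂μ := by ring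
    _ ≤ 1 * (ε / 3) + ε / 3 := by gcongr
    _ < ε := by linarith

variable {E : Type*} [MetricSpace E]

/-- Two Lipschitz maps are compared at a point through their values on a finite set. -/
theorem dist_le_infDist_add_sum {A B : E → E} {a b : ℝ}
    (hA : ∀ u v, dist (A u) (A v) ≤ a * dist u v) (hB : ∀ u v, dist (B u) (B v) ≤ b * dist u v)
    {K : Finset E} (hK : K.Nonempty) (y : E) :
    dist (A y) (B y) ≤ (a + b) * Metric.infDist y K + ∑ x ∈ K, dist (A x) (B x) := by
  obtain ⟨x, hx, hxy⟩ := K.finite_toSet.isCompact.exists_infDist_eq_dist (by simpa using hK) y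
  rw [hxy]
  have h1 := dist_triangle4 (A y) (A x) (B x) (B y)
  have h2 := hA y x
  have h3 := hB x y
  rw [dist_comm x y] at h3
  have h4 := Finset.single_le_sum (f := fun x => dist (A x) (B x)) (fun _ _ => dist_nonneg) hx
  linarith

variable [MeasurableSpace E] [BorelSpace E]

/-- Lipschitz superposition with an `L^R` Lipschitz function maps local `L^Q` to local `L^P`. -/
theorem LpLocal.superposition {P Q R : ℝ≥0∞} [ENNReal.HolderTriple R Q P] {F : ℝ → E → E}
    (hFm : Measurable fun z : ℝ × E => F z.1 z.2) (hF : ∀ x, LpLocal P fun t => F t x)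
    {L : ℝ → ℝ} (hL : ∀ a b, MemLp L R (volume.restrict (Set.Ioc a b)))
    (hlip : ∀ (t : ℝ) (u v : E), dist (F t u) (F t v) ≤ L t * dist u v)
    {X : ℝ → E} (hX : LpLocal Q X) : LpLocal P fun t => F t (X t) := by
  have hm : Measurable fun t => F t (X t) := hFm.comp (measurable_id.prodMk hX.meas)
  refine ⟨hm, fun x₀ a b => ?_⟩
  have h1 : MemLp (fun t => L t * dist (X t) x₀) P (volume.restrict (Set.Ioc a b)) :=
    (hX.memLp x₀ a b).mul (hL a b)
  refine (h1.add ((hF x₀).memLp x₀ a b)).mono'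
    (measurable_dist_of_real hm measurable_const).aestronglyMeasurable
    (Eventually.of_forall fun t => ?_)
  rw [Real.norm_of_nonneg dist_nonneg]
  exact (dist_triangle _ (F t x₀) _).trans (add_le_add_left (hlip t _ _) _)

/-- Superposition preserves Stepanov almost periodicity. -/
theorem LpLocal.relDense_almostPeriods_superposition {P Q R : ℝ≥0∞} [ENNReal.HolderTriple R Q P]
    (hP : 1 ≤ P) (hP' : P ≠ ⊤) (hQ : 1 ≤ Q) (hQ' : Q ≠ ⊤) (hR : 1 ≤ R) {G : ℝ → E → E}
    (hGl : ∀ x, LpLocal P fun t => G t x)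
    (hGap : ∀ K : Finset E, ∀ ε > 0,
      RelDense {τ | ∀ x ∈ K, τ ∈ almostPeriods P (fun t => G t x) ε})
    {L : ℝ → ℝ} (hLm : Measurable L) {C : ℝ} (hC : 0 < C)
    (hLC : ∀ u, localNorm R L u ≤ ENNReal.ofReal C)
    (hlip : ∀ (t : ℝ) (u v : E), dist (G t u) (G t v) ≤ L t * dist u v)
    {Y : ℝ → E} (hY : LpLocal Q Y) (hYap : ∀ ε > 0, RelDense (almostPeriods Q Y ε))
    {ε : ℝ} (hε : 0 < ε) : RelDense (almostPeriods P (fun t => G t (Y t)) ε) := by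
  have hε₁ : 0 < ε / (6 * C) := by positivity
  obtain ⟨K, hK, hKY⟩ := hY.exists_finset hQ hQ' hYap hε₁
  have hcard : 0 < (K.card : ℝ) := by exact_mod_cast hK.card_pos
  set ε₀ := min (ε / (6 * C)) (ε / (2 * K.card))
  have hε₀ : 0 < ε₀ := lt_min hε₁ (by positivity)
  have hfamG := isAlmostPeriodFamily_biInter K hP hP' (f := fun x t => G t x)
    (fun x _ => hGl x) (hGap K)
  have hfamY := isAlmostPeriodFamily_biInter ({()} : Finset Unit) hQ hQ' (f := fun _ => Y)
    (fun _ _ => hY) (by simpa using! hYap)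
  obtain ⟨l, hl, hd⟩ := hfamG.relDense_inter hfamY hε₀
  refine ⟨l, hl, fun a => ?_⟩
  obtain ⟨τ, ⟨hτG, hτY⟩, hτa⟩ := hd a
  refine ⟨τ, fun u => ?_, hτa⟩
  have hτY' : τ ∈ almostPeriods Q Y ε₀ := hτY () (by simp)
  have hLτ : Measurable fun t => L (t + τ) := hLm.comp (measurable_add_const τ)
  have hYd : Measurable fun t => dist (Y (t + τ)) (Y t) :=
    measurable_dist_of_real (hY.comp_add τ).meas hY.meas
  have hYK := measurable_infDist_of_measurable hY.meas (K : Set E)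
  have hGd : ∀ x, Measurable fun t => dist (G (t + τ) x) (G t x) := fun x =>
    measurable_dist_of_real ((hGl x).comp_add τ).meas (hGl x).meas
  have hLτC : localNorm R (fun t => L (t + τ)) u ≤ ENNReal.ofReal C := by
    rw [localNorm_comp_add hLm]
    exact hLC _
  calc localNorm P (fun t => dist (G (t + τ) (Y (t + τ))) (G t (Y t))) u
      ≤ localNorm P (fun t => (L (t + τ) * dist (Y (t + τ)) (Y t) +
          (L (t + τ) + L t) * Metric.infDist (Y t) K) +
            ∑ x ∈ K, dist (G (t + τ) x) (G t x)) u := by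
        refine localNorm_mono (fun _ => dist_nonneg) (fun t => ?_) u
        rw [add_assoc]
        exact (dist_triangle _ (G (t + τ) (Y t)) _).trans
          (add_le_add (hlip _ _ _) (dist_le_infDist_add_sum (hlip _) (hlip _) hK _))
    _ ≤ (localNorm P (fun t => L (t + τ) * dist (Y (t + τ)) (Y t)) u +
          localNorm P (fun t => (L (t + τ) + L t) * Metric.infDist (Y t) K) u) +
            localNorm P (fun t => ∑ x ∈ K, dist (G (t + τ) x) (G t x)) u :=
        (localNorm_add_le hP ((hLτ.mul hYd).add ((hLτ.add hLm).mul hYK))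
          (Finset.measurable_fun_sum K fun x _ => hGd x) u).trans
          (add_le_add_left (localNorm_add_le hP (hLτ.mul hYd) ((hLτ.add hLm).mul hYK) u) _)
    _ ≤ (localNorm R (fun t => L (t + τ)) u * localNorm Q (fun t => dist (Y (t + τ)) (Y t)) u +
          (localNorm R (fun t => L (t + τ)) u + localNorm R L u) *
            localNorm Q (fun t => Metric.infDist (Y t) K) u) +
            ∑ x ∈ K, localNorm P (fun t => dist (G (t + τ) x) (G t x)) u := by
        refine add_le_add (add_le_add (localNorm_mul_le hLτ hYd u) ?_)
          (localNorm_sum_le hP K (fun x _ => hGd x) u)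
        exact (localNorm_mul_le (hLτ.add hLm) hYK u).trans
          (mul_le_mul_left (localNorm_add_le hR hLτ hLm u) _)
    _ ≤ (ENNReal.ofReal C * ENNReal.ofReal (ε / (6 * C)) +
          (ENNReal.ofReal C + ENNReal.ofReal C) * ENNReal.ofReal (ε / (6 * C))) +
            ∑ _x ∈ K, ENNReal.ofReal (ε / (2 * K.card)) := by
        refine add_le_add (add_le_add (mul_le_mul' hLτC ((hτY' u).trans ?_))
          (mul_le_mul' (add_le_add hLτC (hLC u)) (hKY u)))
          (Finset.sum_le_sum fun x hx => (hτG x hx u).trans ?_)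
        · exact ENNReal.ofReal_le_ofReal (min_le_left _ _)
        · exact ENNReal.ofReal_le_ofReal (min_le_right _ _)
    _ = ENNReal.ofReal ε := by
        rw [← ENNReal.ofReal_sum_of_nonneg fun _ _ => by positivity,
          ← ENNReal.ofReal_add hC.le hC.le, ← ENNReal.ofReal_mul hC.le,
          ← ENNReal.ofReal_mul (by positivity),
          ← ENNReal.ofReal_add (by positivity) (by positivity),
          ← ENNReal.ofReal_add (by positivity) (by positivity), Finset.sum_const, nsmul_eq_mul]
        congr 1
        field_simp
        norm_num

/-- The local distance of two superpositions, compared through a finite set. -/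
theorem LpLocal.toReal_localNorm_superposition_le {P Q R : ℝ≥0∞} [ENNReal.HolderTriple R Q P]
    (hP : 1 ≤ P) (hR : 1 ≤ R) {F G : ℝ → E → E}
    (hF : ∀ x, LpLocal P fun t => F t x) (hG : ∀ x, LpLocal P fun t => G t x)
    {L : ℝ → ℝ} (hLm : Measurable L) {C : ℝ} (hC : 0 < C)
    (hLC : ∀ u, localNorm R L u ≤ ENNReal.ofReal C)
    (hlipF : ∀ (t : ℝ) (u v : E), dist (F t u) (F t v) ≤ L t * dist u v)
    (hlipG : ∀ (t : ℝ) (u v : E), dist (G t u) (G t v) ≤ L t * dist u v)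
    {X Y : ℝ → E} (hX : LpLocal Q X) (hY : LpLocal Q Y) {K : Finset E} (hK : K.Nonempty)
    {δ : ℝ} (hδ : 0 ≤ δ)
    (hKY : ∀ u, localNorm Q (fun t => Metric.infDist (Y t) K) u ≤ ENNReal.ofReal δ) (u : ℝ) :
    (localNorm P (fun t => dist (F t (X t)) (G t (Y t))) u).toReal ≤
      2 * C * δ + (C * (localNorm Q (fun t => dist (X t) (Y t)) u).toReal +
        ∑ x ∈ K, (localNorm P (fun t => dist (F t x) (G t x)) u).toReal) := by
  have hXY : Measurable fun t => dist (X t) (Y t) := measurable_dist_of_real hX.meas hY.meas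
  have hYK := measurable_infDist_of_measurable hY.meas (K : Set E)
  have hH : ∀ x, Measurable fun t => dist (F t x) (G t x) := fun x =>
    measurable_dist_of_real (hF x).meas (hG x).meas
  have hXYt : localNorm Q (fun t => dist (X t) (Y t)) u ≠ ⊤ := (hX.memLp_dist hY _ _).2.ne
  have hHt : ∀ x, localNorm P (fun t => dist (F t x) (G t x)) u ≠ ⊤ := fun x =>
    ((hF x).memLp_dist (hG x) _ _).2.ne
  refine ENNReal.toReal_le_of_le_ofReal (by positivity) ?_
  calc localNorm P (fun t => dist (F t (X t)) (G t (Y t))) u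
      ≤ localNorm P (fun t => (L t + L t) * Metric.infDist (Y t) K + (L t * dist (X t) (Y t) +
            ∑ x ∈ K, dist (F t x) (G t x))) u := by
        refine localNorm_mono (fun _ => dist_nonneg) (fun t => ?_) u
        have h1 := dist_triangle (F t (X t)) (F t (Y t)) (G t (Y t))
        have h2 := hlipF t (X t) (Y t)
        have h3 := dist_le_infDist_add_sum (hlipF t) (hlipG t) hK (Y t)
        linarith
    _ ≤ localNorm P (fun t => (L t + L t) * Metric.infDist (Y t) K) u +
          (localNorm P (fun t => L t * dist (X t) (Y t)) u +
            localNorm P (fun t => ∑ x ∈ K, dist (F t x) (G t x)) u) :=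
        (localNorm_add_le hP ((hLm.add hLm).mul hYK) ((hLm.mul hXY).add
          (Finset.measurable_fun_sum K fun x _ => hH x)) u).trans
          (add_le_add_right (localNorm_add_le hP (hLm.mul hXY)
            (Finset.measurable_fun_sum K fun x _ => hH x) u) _)
    _ ≤ (ENNReal.ofReal C + ENNReal.ofReal C) * ENNReal.ofReal δ +
          (ENNReal.ofReal C * localNorm Q (fun t => dist (X t) (Y t)) u +
            ∑ x ∈ K, localNorm P (fun t => dist (F t x) (G t x)) u) := by
        refine add_le_add ?_ (add_le_add ?_ (localNorm_sum_le hP K (fun x _ => hH x) u))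
        · exact (localNorm_mul_le (hLm.add hLm) hYK u).trans (mul_le_mul'
            ((localNorm_add_le hR hLm hLm u).trans (add_le_add (hLC u) (hLC u))) (hKY u))
        · exact (localNorm_mul_le hLm hXY u).trans (mul_le_mul' (hLC u) le_rfl)
    _ = _ := by
        rw [ENNReal.ofReal_add (by positivity) (by positivity),
          ENNReal.ofReal_add (by positivity) (by positivity),
          ENNReal.ofReal_sum_of_nonneg fun _ _ => ENNReal.toReal_nonneg,
          ENNReal.ofReal_mul hC.le, ENNReal.ofReal_toReal hXYt,
          ENNReal.ofReal_mul (by positivity), two_mul, ENNReal.ofReal_add hC.le hC.le]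
        simp only [ENNReal.ofReal_toReal (hHt _)]

theorem rpow_intervalIntegral_zero_one_eq_localNorm {p : ℝ} (hp : 0 < p) {φ : ℝ → ℝ}
    (hφ : Measurable φ) (h0 : ∀ t, 0 ≤ φ t) (t : ℝ) :
    (∫ s in (0:ℝ)..1, φ (t + s) ^ p) ^ (1 / p) = (localNorm (ENNReal.ofReal p) φ t).toReal := by
  rw [← rpow_intervalIntegral_eq_localNorm hp hφ h0,
    intervalIntegral.integral_comp_add_left (fun s => φ s ^ p) t, add_zero]

end Superposition

/-- superposition in the Stepanov pseudo almost periodic class: if `G` is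
`S^p`-almost periodic uniformly on compacts, `H(t,x) = d(F(t,x), G(t,x))` is Stepanov
`μ`-ergodic of order `p` uniformly on compacts, `F` and `G` are Lipschitz in the second
variable with an `S^r`-bounded `L` (where `1/p = 1/q + 1/r`), and `X` is Stepanov `μ`-pseudo
almost periodic of order `q`, then `t ↦ F(t, X(t))` is Stepanov `μ`-pseudo almost periodic
of order `p`. -/
theorem stmt6 {E : Type*} [MetricSpace E] [CompleteSpace E]
    [MeasurableSpace E] [BorelSpace E]
    (μ : Measure ℝ) (hμ1 : μ Set.univ = ⊤) (hμ2 : ∀ a b : ℝ, μ (Set.Icc a b) < ⊤)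
    (hμH : CondH μ)
    (p q r : ℝ) (hp : 1 ≤ p) (hq : 1 ≤ q) (hr : 1 ≤ r) (hpqr : 1 / p = 1 / q + 1 / r)
    (F G : ℝ → E → E)
    (hFm : Measurable fun z : ℝ × E => F z.1 z.2)
    (hGm : Measurable fun z : ℝ × E => G z.1 z.2)
    (hFl : ∀ x, LocInt p fun t => F t x)
    (hGl : ∀ x, LocInt p fun t => G t x)
    (hGap : SpAPUc p G)
    -- `H(t,x) = d(F(t,x), G(t,x))` is Stepanov `μ`-ergodic of order `p`
    -- uniformly on compact subsets of `E`:
    (hHb : ∀ x : E, ∃ C : ℝ, ∀ t : ℝ,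
      (∫ s in t..(t + 1), dist (F s x) (G s x) ^ p) ≤ C)
    (hHerg : ∀ K : Set E, IsCompact K → ∀ ε > 0, ∃ r₀ : ℝ, ∀ r' ≥ r₀, ∀ x ∈ K,
      (1 / (μ (Set.Icc (-r') r')).toReal) *
          ∫ t in Set.Icc (-r') r',
            (∫ s in (0:ℝ)..1, dist (F (t + s) x) (G (t + s) x) ^ p) ^ (1 / p) ∂μ ≤ ε)
    (L : ℝ → ℝ) (hL0 : ∀ t, 0 ≤ L t) (hLm : Measurable L)
    (hLint : ∀ a b : ℝ, IntervalIntegrable (fun t => L t ^ r) volume a b)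
    (hLbdd : BddAbove (Set.range fun x : ℝ => (∫ t in x..(x + 1), L t ^ r) ^ (1 / r)))
    (hlipF : ∀ (t : ℝ) (u v : E), dist (F t u) (F t v) ≤ L t * dist u v)
    (hlipG : ∀ (t : ℝ) (u v : E), dist (G t u) (G t v) ≤ L t * dist u v)
    (X : ℝ → E) (hX : SpPAP μ q X) :
    SpPAP μ p (fun t => F t (X t)) := by
  have hp0 : 0 < p := by linarith
  have hq0 : 0 < q := by linarith
  have hr0 : 0 < r := by linarith
  have hP : 1 ≤ ENNReal.ofReal p := ENNReal.one_le_ofReal.2 hp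
  have hQ : 1 ≤ ENNReal.ofReal q := ENNReal.one_le_ofReal.2 hq
  have hR : 1 ≤ ENNReal.ofReal r := ENNReal.one_le_ofReal.2 hr
  have : ENNReal.HolderTriple (ENNReal.ofReal r) (ENNReal.ofReal q) (ENNReal.ofReal p) := by
    refine ⟨?_⟩
    rw [← ENNReal.ofReal_inv_of_pos hp0, ← ENNReal.ofReal_inv_of_pos hq0,
      ← ENNReal.ofReal_inv_of_pos hr0, ← ENNReal.ofReal_add (by positivity) (by positivity)]
    congr 1
    simp only [one_div] at hpqr
    rw [hpqr, add_comm]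
  have : IsFiniteMeasureOnCompacts μ := ⟨fun K hK => by
    obtain ⟨a, b, hab⟩ := bddBelow_bddAbove_iff_subset_Icc.1 ⟨hK.bddBelow, hK.bddAbove⟩
    exact (measure_mono hab).trans_lt (hμ2 a b)⟩
  obtain ⟨hXm, hXi, Y, hYm, hYi, hYap, hXY⟩ := hX
  have hXl : LpLocal (ENNReal.ofReal q) X := (lpLocal_iff hq0).2 ⟨hXm, hXi⟩
  have hYl : LpLocal (ENNReal.ofReal q) Y := (lpLocal_iff hq0).2 ⟨hYm, hYi⟩
  have hFl' : ∀ x, LpLocal (ENNReal.ofReal p) fun t => F t x := fun x =>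
    (lpLocal_iff hp0).2 ⟨hFm.comp (measurable_id.prodMk measurable_const), hFl x⟩
  have hGl' : ∀ x, LpLocal (ENNReal.ofReal p) fun t => G t x := fun x =>
    (lpLocal_iff hp0).2 ⟨hGm.comp (measurable_id.prodMk measurable_const), hGl x⟩
  have hLl := (intervalIntegrable_rpow_iff_memLp hr0 hLm hL0).1 hLint
  obtain ⟨C, hC, hLC⟩ : ∃ C > 0, ∀ u, localNorm (ENNReal.ofReal r) L u ≤ ENNReal.ofReal C := by
    obtain ⟨C, hC⟩ := hLbdd
    refine ⟨max C 1, by positivity, fun u => ?_⟩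
    have hfin : localNorm (ENNReal.ofReal r) L u ≠ ⊤ := (hLl u (u + 1)).2.ne
    rw [ENNReal.le_ofReal_iff_toReal_le hfin (by positivity),
      ← rpow_intervalIntegral_eq_localNorm hr0 hLm hL0]
    exact (hC ⟨u, rfl⟩).trans (le_max_left _ _)
  have hYap' : ∀ ε > 0, RelDense (almostPeriods (ENNReal.ofReal q) Y ε) := by
    intro ε hε
    convert hYap ε hε using 1
    ext τ
    exact hYl.mem_almostPeriods_iff hq0 hε.le
  have hGap' : ∀ K : Finset E, ∀ ε > 0,
      RelDense {τ | ∀ x ∈ K, τ ∈ almostPeriods (ENNReal.ofReal p) (fun t => G t x) ε} := by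
    intro K ε hε
    convert hGap K K.finite_toSet.isCompact ε hε using 1
    ext τ
    exact forall₂_congr fun x _ => (hGl' x).mem_almostPeriods_iff hp0 hε.le
  have hf : LpLocal (ENNReal.ofReal p) fun t => F t (X t) :=
    LpLocal.superposition hFm hFl' hLl hlipF hXl
  have hg : LpLocal (ENNReal.ofReal p) fun t => G t (Y t) :=
    LpLocal.superposition hGm hGl' hLl hlipG hYl
  have hH : ∀ x, Measurable fun t => dist (F t x) (G t x) := fun x =>
    measurable_dist_of_real (hFl' x).meas (hGl' x).meas
  have hXYm := measurable_dist_of_real hXm hYm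
  obtain ⟨hf1, hf2⟩ := (lpLocal_iff hp0).1 hf
  obtain ⟨hg1, hg2⟩ := (lpLocal_iff hp0).1 hg
  refine ⟨hf1, hf2, fun t => G t (Y t), hg1, hg2, fun ε hε => ?_, ?_⟩
  · convert LpLocal.relDense_almostPeriods_superposition hP ENNReal.ofReal_ne_top hQ
      ENNReal.ofReal_ne_top hR hGl' hGap' hLm hC hLC hlipG hYl hYap' hε using 1
    ext τ
    exact (hg.mem_almostPeriods_iff hp0 hε.le).symm
  simp only [rpow_intervalIntegral_zero_one_eq_localNorm hp0 (hH _) fun _ => dist_nonneg] at hHerg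
  simp only [rpow_intervalIntegral_zero_one_eq_localNorm hq0 hXYm fun _ => dist_nonneg] at hXY
  simp only [rpow_intervalIntegral_zero_one_eq_localNorm hp0 (measurable_dist_of_real hf1 hg1)
    fun _ => dist_nonneg]
  refine tendsto_average_zero_of_le μ (continuous_toReal_localNorm hp0
    (measurable_dist_of_real hf1 hg1) (fun _ => dist_nonneg) (hf.memLp_dist hg))
    (fun _ => ENNReal.toReal_nonneg) fun ε hε => ?_
  obtain ⟨K, hK, hKY⟩ := hYl.exists_finset hQ ENNReal.ofReal_ne_top hYap'
    (show 0 < ε / (2 * C) by positivity)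
  have hcard : 0 < (K.card : ℝ) := by exact_mod_cast hK.card_pos
  have hc₁ := continuous_toReal_localNorm hq0 hXYm (fun _ => dist_nonneg) (hXl.memLp_dist hYl)
  have hc₂ : ∀ x, Continuous fun u =>
      (localNorm (ENNReal.ofReal p) (fun t => dist (F t x) (G t x)) u).toReal := fun x =>
    continuous_toReal_localNorm hp0 (hH x) (fun _ => dist_nonneg) ((hFl' x).memLp_dist (hGl' x))
  refine ⟨fun u => C * (localNorm (ENNReal.ofReal q) (fun t => dist (X t) (Y t)) u).toReal +
      ∑ x ∈ K, (localNorm (ENNReal.ofReal p) (fun t => dist (F t x) (G t x)) u).toReal,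
    (hc₁.const_mul C).add (continuous_finsetSum K fun x _ => hc₂ x), fun u => ?_, ?_⟩
  · refine (LpLocal.toReal_localNorm_superposition_le hP hR hFl' hGl' hLm hC hLC hlipF hlipG
      hXl hYl hK (show 0 ≤ ε / (2 * C) by positivity) hKY u).trans_eq ?_
    congr 1
    field_simp
  obtain ⟨r₀, hr₀⟩ := hHerg K K.finite_toSet.isCompact (ε / (2 * K.card)) (by positivity)
  filter_upwards [eventually_ge_atTop r₀, hXY.eventually
    (ge_mem_nhds (show 0 < ε / (2 * C) by positivity))] with ρ hρ hρXY
  have hInt : ∀ {φ : ℝ → ℝ}, Continuous φ → IntegrableOn φ (Set.Icc (-ρ) ρ) μ := fun hφ =>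
    hφ.continuousOn.integrableOn_compact isCompact_Icc
  rw [integral_add (hInt (hc₁.const_mul C)) (hInt (continuous_finsetSum K fun x _ => hc₂ x)),
    integral_const_mul, integral_finsetSum K fun x _ => hInt (hc₂ x), mul_add, Finset.mul_sum,
    mul_left_comm]
  calc _ ≤ C * (ε / (2 * C)) + ∑ _x ∈ K, ε / (2 * K.card) := by
        refine add_le_add (mul_le_mul_of_nonneg_left hρXY hC.le)
          (Finset.sum_le_sum fun x hx => hr₀ ρ hρ x hx)
    _ = ε := by
        rw [Finset.sum_const, nsmul_eq_mul]
        field_simp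
        norm_num
end

section
/- Let μ be a positive Borel measure on ℝ with μ(ℝ) = ∞ and μ(I) < ∞ for every bounded interval I, satisfying condition (H). Let δ > 0, p > 2 and q > 0 with 1/2 = 1/p + 1/q. Let K : ℝ → [0,∞) be S^p-bounded and let h : ℝ → ℝ be locally q-integrable, S^q-bounded, and such that the function t ↦ (∫_0^1 |h(t+s)|^q ds)^{1/q} is μ-ergodic. Then the function Φ(t) = (∫_{-∞}^t e^{-2δ(t-s)} K(s)² h(s)² ds)^{1/2} is μ-ergodic, i.e. lim_{r→∞} (1/μ([-r,r])) ∫_{[-r,r]} Φ(t) dμ(t) = 0. -/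
open MeasureTheory Filter Topology

/-- `φ : ℝ → ℝ` is `μ`-ergodic. -/
def MuErgodic (μ : Measure ℝ) (φ : ℝ → ℝ) : Prop :=
  Tendsto (fun r : ℝ => (1 / (μ (Set.Icc (-r) r)).toReal) *
      ∫ t in Set.Icc (-r) r, φ t ∂μ) atTop (𝓝 0)

/-- The averages of `φ` over `[-r, r]` with respect to `μ` tend to `0`. -/
def LMuErgodic (μ : Measure ℝ) (φ : ℝ → ENNReal) : Prop :=
  Tendsto (fun r : ℝ => (∫⁻ t in Set.Icc (-r) r, φ t ∂μ) / μ (Set.Icc (-r) r)) atTop (𝓝 0)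

lemma tendsto_measure_Icc_neg_self (μ : Measure ℝ) (hμ : μ Set.univ = ⊤) :
    Tendsto (fun r : ℝ => μ (Set.Icc (-r) r)) atTop (𝓝 ⊤) := by
  have hU : (⋃ r : ℝ, Set.Icc (-r) r) = Set.univ :=
    Set.eq_univ_of_forall fun x => Set.mem_iUnion.2 ⟨|x|, abs_le.1 le_rfl⟩
  rw [← hμ, ← hU]
  exact tendsto_measure_iUnion_atTop fun r s hrs => Set.Icc_subset_Icc (neg_le_neg hrs) hrs

lemma setLIntegral_div_le {μ : Measure ℝ} {φ : ℝ → ENNReal} {C : ENNReal} (hC : ∀ t, φ t ≤ C)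
    (s : Set ℝ) : (∫⁻ t in s, φ t ∂μ) / μ s ≤ C := by
  refine ENNReal.div_le_of_le_mul ?_
  calc ∫⁻ t in s, φ t ∂μ ≤ ∫⁻ _ in s, C ∂μ := lintegral_mono hC
    _ = C * μ s := setLIntegral_const _ _

lemma LMuErgodic.mono {μ : Measure ℝ} {φ ψ : ℝ → ENNReal} (hψ : LMuErgodic μ ψ)
    (h : ∀ t, φ t ≤ ψ t) : LMuErgodic μ φ :=
  tendsto_of_tendsto_of_tendsto_of_le_of_le tendsto_const_nhds hψ (fun _ => zero_le)
    fun _ => ENNReal.div_le_div_right (lintegral_mono h) _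

lemma MuErgodic.lMuErgodic {μ : Measure ℝ} {φ : ℝ → ℝ} (hφ : MuErgodic μ φ)
    (h0 : ∀ t, 0 ≤ φ t) (hm : Measurable φ) {C : ℝ} (hC : ∀ t, φ t ≤ C) :
    LMuErgodic μ fun t => ENNReal.ofReal (φ t) := by
  have hfin (r : ℝ) : (∫⁻ t in Set.Icc (-r) r, ENNReal.ofReal (φ t) ∂μ) / μ (Set.Icc (-r) r) ≠ ⊤ :=
    ((setLIntegral_div_le (fun t => ENNReal.ofReal_le_ofReal (hC t)) _).trans_lt
      ENNReal.ofReal_lt_top).ne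
  refine (ENNReal.tendsto_toReal_iff hfin ENNReal.zero_ne_top).1 ?_
  refine hφ.congr fun r => ?_
  rw [integral_eq_lintegral_of_nonneg_ae (ae_of_all _ h0) hm.aestronglyMeasurable,
    ENNReal.toReal_div]
  ring

lemma LMuErgodic.muErgodic {μ : Measure ℝ} {φ : ℝ → ℝ}
    (hφ : LMuErgodic μ fun t => ‖φ t‖ₑ) : MuErgodic μ φ := by
  rw [MuErgodic, tendsto_zero_iff_enorm_tendsto_zero]
  refine tendsto_of_tendsto_of_tendsto_of_le_of_le tendsto_const_nhds hφ (fun _ => zero_le)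
    fun r => ?_
  rw [enorm_mul, mul_comm, ENNReal.div_eq_inv_mul, mul_comm (_⁻¹)]
  refine mul_le_mul' (enorm_integral_le_lintegral_enorm _) ?_
  rw [one_div, ← ENNReal.toReal_inv, Real.enorm_eq_ofReal ENNReal.toReal_nonneg]
  exact ENNReal.ofReal_toReal_le

lemma CondH.map_le {μ : Measure ℝ} (hμ : ∀ a b : ℝ, μ (Set.Icc a b) < ⊤) (hH : CondH μ) (τ : ℝ) :
    ∃ B : ENNReal, B ≠ ⊤ ∧ ∃ ρ : Measure ℝ, ρ Set.univ ≠ ⊤ ∧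
      μ.map (fun t => t + -τ) ≤ B • μ + ρ := by
  obtain ⟨β, -, a, b, hβ⟩ := hH τ
  have hm : Measurable fun t : ℝ => t + -τ := by fun_prop
  refine ⟨ENNReal.ofReal β, ENNReal.ofReal_ne_top, (μ.map fun t => t + -τ).restrict (Set.Icc a b), ?_, ?_⟩
  · rw [Measure.restrict_apply_univ, Measure.map_apply hm measurableSet_Icc]
    refine ((measure_mono ?_).trans_lt (hμ (a + τ) (b + τ))).ne
    rintro x ⟨h1, h2⟩
    constructor <;> linarith
  · refine Measure.le_iff.2 fun s hs => ?_
    have hd := hβ (s \ Set.Icc a b) (hs.diff measurableSet_Icc) Set.sdiff_inter_self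
    rw [Set.image_add_right, ← Measure.map_apply hm (hs.diff measurableSet_Icc)] at hd
    rw [Measure.add_apply, Measure.restrict_apply hs, Measure.smul_apply, smul_eq_mul, add_comm]
    refine (measure_le_inter_add_sdiff _ s (Set.Icc a b)).trans ?_
    gcongr
    exact hd.trans (by gcongr; exact Set.sdiff_subset)

lemma CondH.eventually_measure_Icc_add_le {μ : Measure ℝ} (hμ1 : μ Set.univ = ⊤)
    (hμ : ∀ a b : ℝ, μ (Set.Icc a b) < ⊤) (hH : CondH μ) (k : ℝ) :
    ∃ D : ENNReal, D ≠ ⊤ ∧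
      ∀ᶠ r in atTop, μ (Set.Icc (-(r + k)) (r + k)) ≤ D * μ (Set.Icc (-r) r) := by
  obtain ⟨B₁, hB₁, ρ₁, hρ₁, h₁⟩ := hH.map_le hμ k
  obtain ⟨B₂, hB₂, ρ₂, hρ₂, h₂⟩ := hH.map_le hμ (-k)
  refine ⟨1 + (B₁ + ρ₁ Set.univ) + (B₂ + ρ₂ Set.univ), by simp [*], ?_⟩
  have h1 : ∀ᶠ r : ℝ in atTop, 1 < μ (Set.Icc (-r) r) :=
    (tendsto_measure_Icc_neg_self μ hμ1).eventually (lt_mem_nhds ENNReal.one_lt_top)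
  filter_upwards [h1, eventually_ge_atTop |k|] with r hr hk
  have key {τ : ℝ} {B : ENNReal} {ρ : Measure ℝ} (h : μ.map (fun t => t + -τ) ≤ B • μ + ρ) :
      μ ((fun t => t + -τ) ⁻¹' Set.Icc (-r) r) ≤ (B + ρ Set.univ) * μ (Set.Icc (-r) r) := by
    rw [← Measure.map_apply (by fun_prop) measurableSet_Icc, add_mul]
    refine (h _).trans ?_
    rw [Measure.add_apply, Measure.smul_apply, smul_eq_mul]
    gcongr
    exact (measure_mono (Set.subset_univ _)).trans (le_mul_of_one_le_right' hr.le)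
  have hsub : Set.Icc (-(r + k)) (r + k) ⊆ Set.Icc (-r) r ∪ (fun t => t + -k) ⁻¹' Set.Icc (-r) r ∪
      (fun t => t + -(-k)) ⁻¹' Set.Icc (-r) r := by
    rintro x ⟨hx1, hx2⟩
    obtain ⟨hk1, hk2⟩ := abs_le.1 hk
    simp only [Set.mem_union, Set.mem_preimage, Set.mem_Icc]
    grind
  rw [add_mul, add_mul, one_mul]
  refine (measure_mono hsub).trans ((measure_union_le _ _).trans ?_)
  exact add_le_add ((measure_union_le _ _).trans (add_le_add le_rfl (key h₁))) (key h₂)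

lemma LMuErgodic.comp_sub {μ : Measure ℝ} (hμ1 : μ Set.univ = ⊤)
    (hμ : ∀ a b : ℝ, μ (Set.Icc a b) < ⊤) (hH : CondH μ) {φ : ℝ → ENNReal}
    (hφ : LMuErgodic μ φ) (hm : Measurable φ) {C : ENNReal} (hCt : C ≠ ⊤) (hC : ∀ t, φ t ≤ C)
    {k : ℝ} (hk : 0 ≤ k) : LMuErgodic μ fun t => φ (t - k) := by
  obtain ⟨B, hB, ρ, hρ, hle⟩ := hH.map_le hμ k
  obtain ⟨D, hD, hDle⟩ := hH.eventually_measure_Icc_add_le hμ1 hμ k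
  have htop := tendsto_measure_Icc_neg_self μ hμ1
  have hlim : Tendsto (fun r : ℝ => B * D * ((∫⁻ t in Set.Icc (-(r + k)) (r + k), φ t ∂μ) /
      μ (Set.Icc (-(r + k)) (r + k))) + C * ρ Set.univ / μ (Set.Icc (-r) r)) atTop (𝓝 0) := by
    have h1 := ENNReal.Tendsto.const_mul (a := B * D)
      (Tendsto.comp hφ (tendsto_atTop_add_const_right atTop k tendsto_id))
      (Or.inr (ENNReal.mul_ne_top hB hD))
    have h2 := ENNReal.Tendsto.const_div (a := C * ρ Set.univ) htop
      (Or.inr (ENNReal.mul_ne_top hCt hρ))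
    simpa using h1.add h2
  refine tendsto_of_tendsto_of_tendsto_of_le_of_le' tendsto_const_nhds hlim
    (Eventually.of_forall fun _ => zero_le) ?_
  filter_upwards [hDle, htop.eventually (lt_mem_nhds ENNReal.zero_lt_top)] with r hr h0
  have hmap : Measurable fun t : ℝ => t + -k := by fun_prop
  set J := Set.Icc (-(r + k)) (r + k) with hJ
  have hJ0 : μ J ≠ 0 :=
    (h0.trans_le (measure_mono (Set.Icc_subset_Icc (by linarith) (by linarith)))).ne'
  have hint : ∫⁻ t in Set.Icc (-r) r, φ (t - k) ∂μ ≤ B * ∫⁻ t in J, φ t ∂μ + C * ρ Set.univ := by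
    calc ∫⁻ t in Set.Icc (-r) r, φ (t - k) ∂μ
        ≤ ∫⁻ t in (fun t => t + -k) ⁻¹' J, φ (t + -k) ∂μ := by
          refine lintegral_mono_set fun x hx => ?_
          simp only [hJ, Set.mem_preimage, Set.mem_Icc] at hx ⊢
          constructor <;> linarith
      _ = ∫⁻ t in J, φ t ∂(μ.map fun t => t + -k) := (setLIntegral_map measurableSet_Icc hm hmap).symm
      _ ≤ ∫⁻ t in J, φ t ∂(B • μ + ρ) := lintegral_mono' (Measure.restrict_mono le_rfl hle) le_rfl
      _ = B * ∫⁻ t in J, φ t ∂μ + ∫⁻ t in J, φ t ∂ρ := by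
          rw [Measure.restrict_add, lintegral_add_measure, Measure.restrict_smul,
            lintegral_smul_measure, smul_eq_mul]
      _ ≤ _ := by
          gcongr
          calc ∫⁻ t in J, φ t ∂ρ ≤ ∫⁻ _ in J, C ∂ρ := lintegral_mono hC
            _ = C * ρ J := setLIntegral_const _ _
            _ ≤ _ := by gcongr; exact Set.subset_univ _
  calc (∫⁻ t in Set.Icc (-r) r, φ (t - k) ∂μ) / μ (Set.Icc (-r) r)
      ≤ (B * ∫⁻ t in J, φ t ∂μ + C * ρ Set.univ) / μ (Set.Icc (-r) r) :=
        ENNReal.div_le_div_right hint _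
    _ = B * (∫⁻ t in J, φ t ∂μ) / μ (Set.Icc (-r) r) + C * ρ Set.univ / μ (Set.Icc (-r) r) :=
        ENNReal.add_div
    _ ≤ _ := by
        gcongr
        refine ENNReal.div_le_of_le_mul ?_
        calc B * ∫⁻ t in J, φ t ∂μ
            = B * (((∫⁻ t in J, φ t ∂μ) / μ J) * μ J) := by
              rw [ENNReal.div_mul_cancel hJ0 (hμ _ _).ne]
          _ ≤ B * (((∫⁻ t in J, φ t ∂μ) / μ J) * (D * μ (Set.Icc (-r) r))) := by gcongr
          _ = _ := by ring

lemma LMuErgodic.tsum_mul {μ : Measure ℝ} {w : ℕ → ENNReal} (hw : ∑' k, w k ≠ ⊤)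
    {φ : ℕ → ℝ → ENNReal} (hm : ∀ k, Measurable (φ k)) {C : ENNReal} (hCt : C ≠ ⊤)
    (hC : ∀ k t, φ k t ≤ C) (hφ : ∀ k, LMuErgodic μ (φ k)) :
    LMuErgodic μ fun t => ∑' k, w k * φ k t := by
  have hlim : Tendsto (fun r : ℝ => ∫⁻ k, w k * ((∫⁻ t in Set.Icc (-r) r, φ k t ∂μ) /
      μ (Set.Icc (-r) r)) ∂Measure.count) atTop (𝓝 (∫⁻ _ : ℕ, 0 ∂Measure.count)) := by
    refine tendsto_lintegral_filter_of_dominated_convergence (fun k => w k * C)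
      (Eventually.of_forall fun _ => measurable_from_nat)
      (Eventually.of_forall fun r => ae_of_all _ fun k => ?_) ?_ (ae_of_all _ fun k => ?_)
    · exact mul_le_mul' le_rfl (setLIntegral_div_le (hC k) _)
    · rw [lintegral_count, ENNReal.tsum_mul_right]
      exact ENNReal.mul_ne_top hw hCt
    · simpa using ENNReal.Tendsto.const_mul (hφ k) (Or.inr (ENNReal.ne_top_of_tsum_ne_top hw k))
  rw [lintegral_zero] at hlim
  refine hlim.congr fun r => ?_
  rw [lintegral_count, lintegral_tsum fun k => ((hm k).const_mul _).aemeasurable, div_eq_mul_inv,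
    ← ENNReal.tsum_mul_right]
  refine tsum_congr fun k => ?_
  rw [lintegral_const_mul _ (hm k), div_eq_mul_inv, mul_assoc]

lemma ENNReal.rpow_tsum_le_tsum_rpow (a : ℕ → ENNReal) {p : ℝ} (hp : 0 < p) (hp1 : p ≤ 1) :
    (∑' k, a k) ^ p ≤ ∑' k, a k ^ p := by
  have hfin (n : ℕ) : (∑ k ∈ Finset.range n, a k) ^ p ≤ ∑ k ∈ Finset.range n, a k ^ p := by
    induction n with
    | zero => simp [hp]
    | succ n ih =>
      rw [Finset.sum_range_succ, Finset.sum_range_succ]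
      exact (ENNReal.rpow_add_le_add_rpow _ _ hp.le hp1).trans (by gcongr)
  have hlim := (ENNReal.continuous_rpow_const (y := p)).continuousAt.tendsto.comp
    (ENNReal.tendsto_nat_tsum a)
  exact le_of_tendsto' hlim fun n => (hfin n).trans (ENNReal.sum_le_tsum _)

lemma lintegral_Ioc_enorm_rpow_eq {f : ℝ → ℝ} {q : ℝ} (hq : 0 < q) {x y : ℝ} (hxy : x ≤ y)
    (hf : IntervalIntegrable (fun t => |f t| ^ q) volume x y) :
    (∫⁻ s in Set.Ioc x y, ‖f s‖ₑ ^ q) ^ (1 / q) =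
      ENNReal.ofReal ((∫ s in x..y, |f s| ^ q) ^ (1 / q)) := by
  have h0 (s : ℝ) : 0 ≤ |f s| ^ q := by positivity
  rw [← ENNReal.ofReal_rpow_of_nonneg (intervalIntegral.integral_nonneg hxy fun s _ => h0 s)
      (by positivity), intervalIntegral.integral_of_le hxy,
    ofReal_integral_eq_lintegral_ofReal ((intervalIntegrable_iff_integrableOn_Ioc_of_le hxy).1 hf)
      (ae_of_all _ h0)]
  congr 2 with s
  rw [← ENNReal.ofReal_rpow_of_nonneg (abs_nonneg _) hq.le, Real.enorm_eq_ofReal_abs]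

lemma measurable_stepanov_norm {h : ℝ → ℝ} (hm : Measurable h) (q : ℝ) :
    Measurable fun t => (∫ s in (0:ℝ)..1, |h (t + s)| ^ q) ^ (1 / q) := by
  simp only [intervalIntegral.integral_of_le zero_le_one]
  have hF : StronglyMeasurable (Function.uncurry fun t s : ℝ => |h (t + s)| ^ q) := by
    refine Measurable.stronglyMeasurable ?_
    unfold Function.uncurry
    fun_prop
  exact hF.integral_prod_right.measurable.pow_const _

lemma enorm_sqrt_integral_le {δ p q : ℝ} (hδ : 0 < δ) (hp : 2 < p)
    (hpq : (1:ℝ) / 2 = 1 / p + 1 / q) {K h : ℝ → ℝ} (hKm : Measurable K) (hhm : Measurable h)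
    (t : ℝ) :
    ‖Real.sqrt (∫ s in Set.Iic t, Real.exp (-2 * δ * (t - s)) * K s ^ 2 * h s ^ 2)‖ₑ ≤
      ∑' k : ℕ, ENNReal.ofReal (Real.exp (-δ * k)) *
        ((∫⁻ s in Set.Ioc (t - (k + 1)) (t - (k + 1) + 1), ‖K s‖ₑ ^ p) ^ (1 / p) *
          (∫⁻ s in Set.Ioc (t - (k + 1)) (t - (k + 1) + 1), ‖h s‖ₑ ^ q) ^ (1 / q)) := by
  set F : ℝ → ℝ := fun s => Real.exp (-2 * δ * (t - s)) * K s ^ 2 * h s ^ 2 with hF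
  have hF0 (s : ℝ) : 0 ≤ F s := by positivity
  set I : ℕ → Set ℝ := fun k => Set.Ioc (t - (k + 1)) (t - (k + 1) + 1) with hI
  have hcover : Set.Iic t ⊆ ⋃ k, I k := by
    intro s hs
    refine Set.mem_iUnion.2 ⟨⌊t - s⌋₊, ?_⟩
    have h1 := Nat.floor_le (sub_nonneg.2 (Set.mem_Iic.1 hs))
    have h2 := Nat.lt_floor_add_one (t - s)
    constructor <;> linarith
  have hroot : ‖Real.sqrt (∫ s in Set.Iic t, F s)‖ₑ ≤ (∫⁻ s in Set.Iic t, ‖F s‖ₑ) ^ (1 / 2 : ℝ) := by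
    rw [Real.sqrt_eq_rpow, Real.enorm_rpow_of_nonneg (integral_nonneg hF0) (by norm_num)]
    gcongr
    exact enorm_integral_le_lintegral_enorm _
  have hpiece (k : ℕ) : (∫⁻ s in I k, ‖F s‖ₑ) ^ (1 / 2 : ℝ) ≤ ENNReal.ofReal (Real.exp (-δ * k)) *
      ((∫⁻ s in I k, ‖K s‖ₑ ^ p) ^ (1 / p) * (∫⁻ s in I k, ‖h s‖ₑ ^ q) ^ (1 / q)) := by
    have hle : ∫⁻ s in I k, ‖F s‖ₑ ≤ ENNReal.ofReal (Real.exp (-δ * k)) ^ (2 : ℝ) *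
        ∫⁻ s in I k, ((fun s => ‖K s‖ₑ) * fun s => ‖h s‖ₑ) s ^ (2 : ℝ) := by
      rw [← lintegral_const_mul _ (by fun_prop)]
      refine setLIntegral_mono' measurableSet_Ioc fun s hs => ?_
      rw [← ENNReal.mul_rpow_of_nonneg _ _ (by norm_num), ENNReal.rpow_two, Pi.mul_apply,
        ← Real.enorm_of_nonneg (Real.exp_nonneg _), ← enorm_mul, ← enorm_mul, ← enorm_pow,
        Real.enorm_of_nonneg (hF0 s), Real.enorm_of_nonneg (sq_nonneg _)]
      refine ENNReal.ofReal_le_ofReal ?_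
      rw [mul_pow, mul_pow, ← Real.exp_nat_mul, ← mul_assoc]
      have hexp : -2 * δ * (t - s) ≤ (2 : ℕ) * (-δ * k) := by
        have := hs.2
        push_cast
        nlinarith
      simp only [hF]
      gcongr ?_ * _ * _
      exact Real.exp_le_exp.2 hexp
    calc (∫⁻ s in I k, ‖F s‖ₑ) ^ (1 / 2 : ℝ)
        ≤ (ENNReal.ofReal (Real.exp (-δ * k)) ^ (2 : ℝ) *
            ∫⁻ s in I k, ((fun s => ‖K s‖ₑ) * fun s => ‖h s‖ₑ) s ^ (2 : ℝ)) ^ (1 / 2 : ℝ) := by gcongr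
      _ = ENNReal.ofReal (Real.exp (-δ * k)) *
            (∫⁻ s in I k, ((fun s => ‖K s‖ₑ) * fun s => ‖h s‖ₑ) s ^ (2 : ℝ)) ^ (1 / 2 : ℝ) := by
          rw [ENNReal.mul_rpow_of_nonneg _ _ (by norm_num), ← ENNReal.rpow_mul]
          norm_num
      _ ≤ _ := by
          gcongr
          exact ENNReal.lintegral_Lp_mul_le_Lq_mul_Lr two_pos hp hpq _ (by fun_prop) (by fun_prop)
  calc _ ≤ (∫⁻ s in Set.Iic t, ‖F s‖ₑ) ^ (1 / 2 : ℝ) := hroot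
    _ ≤ (∑' k, ∫⁻ s in I k, ‖F s‖ₑ) ^ (1 / 2 : ℝ) := by
        gcongr
        exact (lintegral_mono_set hcover).trans (lintegral_iUnion_le _ _)
    _ ≤ ∑' k, (∫⁻ s in I k, ‖F s‖ₑ) ^ (1 / 2 : ℝ) :=
        ENNReal.rpow_tsum_le_tsum_rpow _ (by norm_num) (by norm_num)
    _ ≤ _ := ENNReal.tsum_le_tsum hpiece

/-- if `K` is `S^p`-bounded, `h` is `S^q`-bounded with `μ`-ergodic Stepanov
norm `t ↦ (∫_0^1 |h(t+s)|^q ds)^{1/q}` (where `1/2 = 1/p + 1/q`, `p > 2`), then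
`Φ(t) = (∫_{-∞}^t e^{-2δ(t-s)} K(s)² h(s)² ds)^{1/2}` is `μ`-ergodic. -/
theorem stmt11 (μ : Measure ℝ) (hμ1 : μ Set.univ = ⊤)
    (hμ2 : ∀ a b : ℝ, μ (Set.Icc a b) < ⊤) (hμH : CondH μ)
    (δ p q : ℝ) (hδ : 0 < δ) (hp : 2 < p) (hq : 0 < q)
    (hpq : (1:ℝ) / 2 = 1 / p + 1 / q)
    (K : ℝ → ℝ) (hK0 : ∀ t, 0 ≤ K t) (hKm : Measurable K)
    (hKint : ∀ a b : ℝ, IntervalIntegrable (fun t => K t ^ p) volume a b)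
    (hKbdd : BddAbove (Set.range fun x : ℝ => (∫ t in x..(x + 1), K t ^ p) ^ (1 / p)))
    (h : ℝ → ℝ) (hhm : Measurable h)
    (hhint : ∀ a b : ℝ, IntervalIntegrable (fun t => |h t| ^ q) volume a b)
    (hhbdd : BddAbove (Set.range fun x : ℝ => (∫ t in x..(x + 1), |h t| ^ q) ^ (1 / q)))
    (hherg : MuErgodic μ (fun t => (∫ s in (0:ℝ)..1, |h (t + s)| ^ q) ^ (1 / q))) :
    MuErgodic μ (fun t =>
      Real.sqrt (∫ s in Set.Iic t, Real.exp (-2 * δ * (t - s)) * K s ^ 2 * h s ^ 2)) := by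
  set H : ℝ → ℝ := fun t => (∫ s in (0:ℝ)..1, |h (t + s)| ^ q) ^ (1 / q) with hH
  have hH_eq (t : ℝ) : H t = (∫ s in t..(t + 1), |h s| ^ q) ^ (1 / q) := by
    simp only [hH, intervalIntegral.integral_comp_add_left (fun s => |h s| ^ q) t, add_zero]
  obtain ⟨M, hM⟩ := hKbdd
  obtain ⟨C, hC⟩ := hhbdd
  have hHC (t : ℝ) : H t ≤ C := hH_eq t ▸ hC (Set.mem_range_self t)
  have hH0 (t : ℝ) : 0 ≤ H t :=
    Real.rpow_nonneg (intervalIntegral.integral_nonneg zero_le_one fun s _ => by positivity) _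
  have hHm : Measurable H := measurable_stepanov_norm hhm q
  have hHL : LMuErgodic μ fun t => ENNReal.ofReal (H t) := hherg.lMuErgodic hH0 hHm hHC
  have hsum : ∑' k : ℕ, ENNReal.ofReal (Real.exp (-δ * k)) * ENNReal.ofReal M ≠ ⊤ := by
    rw [ENNReal.tsum_mul_right]
    refine ENNReal.mul_ne_top ?_ ENNReal.ofReal_ne_top
    have hs : Summable fun k : ℕ => Real.exp (-δ * k) := by
      simpa [mul_comm] using Real.summable_exp_nat_mul_iff.2 (neg_lt_zero.2 hδ)
    exact hs.tsum_ofReal_ne_top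
  have hmain : LMuErgodic μ fun t => ∑' k : ℕ, ENNReal.ofReal (Real.exp (-δ * k)) *
      ENNReal.ofReal M * ENNReal.ofReal (H (t - (k + 1))) :=
    LMuErgodic.tsum_mul hsum (fun k => by fun_prop) (ENNReal.ofReal_ne_top (r := C))
      (fun k t => ENNReal.ofReal_le_ofReal (hHC _))
      fun k => hHL.comp_sub hμ1 hμ2 hμH hHm.ennreal_ofReal ENNReal.ofReal_ne_top
        (fun t => ENNReal.ofReal_le_ofReal (hHC t)) (by positivity)
  refine (hmain.mono fun t => ?_).muErgodic
  refine (enorm_sqrt_integral_le hδ hp hpq hKm hhm t).trans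
    (ENNReal.tsum_le_tsum fun k => ?_)
  have hle (x : ℝ) : x ≤ x + 1 := by linarith
  have hK_abs : (fun t => |K t| ^ p) = fun t => K t ^ p := by
    funext t
    rw [abs_of_nonneg (hK0 t)]
  rw [lintegral_Ioc_enorm_rpow_eq hq (hle _) (hhint _ _), ← hH_eq, mul_assoc,
    lintegral_Ioc_enorm_rpow_eq (by linarith) (hle _) (by rw [hK_abs]; exact hKint _ _), hK_abs]
  gcongr
  exact hM (Set.mem_range_self _)
end
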